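/- arXiv:1601.03791 — 2 statements merged into one kernel-verified Lean document; each statement's English description precedes it below -/
import Mathlib

section
/- Let k = r + t, where k + 3 ≤ 2r ≤ 2k and t ≥ 0, let G_r := K̄_{2r−2} ∨ (K̄_{2r−3} + K₃), and let H := G_r ∨ K_{2t}. Then |H| = 2k + 2r − 2 ≥ 3k+1, δ(H) = 2k−2, α(H) = 2r−2 = |H| − 2k, and H does not contain k pairwise vertex-disjoint cycles. -/
/-- `G` contains `n` pairwise vertex-disjoint cycles. -/
def SimpleGraph.HasNDisjointCycles {V : Type*} (G : SimpleGraph V) (n : ℕ) : Prop :=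
  ∃ f : Fin n → Σ v : V, G.Walk v v,
    (∀ i, (f i).2.IsCycle) ∧
    ∀ i j, i ≠ j → ∀ v, v ∈ (f i).2.support → v ∉ (f j).2.support

/-- The independence number of `G`: the largest size of an independent set of vertices. -/
noncomputable def SimpleGraph.indepNum' {V : Type*} (G : SimpleGraph V) : ℕ :=
  sSup {n | ∃ s : Finset V, s.card = n ∧ ∀ v ∈ s, ∀ w ∈ s, v ≠ w → ¬ G.Adj v w}

/-- The join `G ∨ H` of two graphs: their disjoint union together with all edges between the
two vertex sets. -/
def SimpleGraph.join {α β : Type*} (G : SimpleGraph α) (H : SimpleGraph β) :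
    SimpleGraph (α ⊕ β) where
  Adj x y :=
    Sum.elim (fun a => Sum.elim (fun b => G.Adj a b) (fun _ => True) y)
             (fun a => Sum.elim (fun _ => True) (fun b => H.Adj a b) y) x
  symm := by
    constructor
    rintro (a | a) (b | b) h
    · exact G.adj_symm h
    · trivial
    · trivial
    · exact H.adj_symm h
  loopless := by
    constructor
    rintro (a | a) h
    · exact G.loopless.irrefl a h
    · exact H.loopless.irrefl a h

instance {α β : Type*} (G : SimpleGraph α) (H : SimpleGraph β) [DecidableRel G.Adj]
    [DecidableRel H.Adj] : DecidableRel (G.join H).Adj := fun x y =>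
  match x, y with
  | Sum.inl a, Sum.inl b => inferInstanceAs (Decidable (G.Adj a b))
  | Sum.inl _, Sum.inr _ => inferInstanceAs (Decidable True)
  | Sum.inr _, Sum.inl _ => inferInstanceAs (Decidable True)
  | Sum.inr a, Sum.inr b => inferInstanceAs (Decidable (H.Adj a b))

/-- The disjoint union `G + H` of two graphs. -/
def SimpleGraph.disjUnion {α β : Type*} (G : SimpleGraph α) (H : SimpleGraph β) :
    SimpleGraph (α ⊕ β) where
  Adj x y :=
    Sum.elim (fun a => Sum.elim (fun b => G.Adj a b) (fun _ => False) y)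
             (fun a => Sum.elim (fun _ => False) (fun b => H.Adj a b) y) x
  symm := by
    constructor
    rintro (a | a) (b | b) h
    · exact G.adj_symm h
    · exact h.elim
    · exact h.elim
    · exact H.adj_symm h
  loopless := by
    constructor
    rintro (a | a) h
    · exact G.loopless.irrefl a h
    · exact H.loopless.irrefl a h

instance {α β : Type*} (G : SimpleGraph α) (H : SimpleGraph β) [DecidableRel G.Adj]
    [DecidableRel H.Adj] : DecidableRel (G.disjUnion H).Adj := fun x y =>
  match x, y with
  | Sum.inl a, Sum.inl b => inferInstanceAs (Decidable (G.Adj a b))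
  | Sum.inl _, Sum.inr _ => inferInstanceAs (Decidable False)
  | Sum.inr _, Sum.inl _ => inferInstanceAs (Decidable False)
  | Sum.inr a, Sum.inr b => inferInstanceAs (Decidable (H.Adj a b))

/-- The graph `G_r := K̄_{2r-2} ∨ (K̄_{2r-3} + K₃)`. -/
def Gr (r : ℕ) : SimpleGraph (Fin (2 * r - 2) ⊕ (Fin (2 * r - 3) ⊕ Fin 3)) :=
  SimpleGraph.join (⊥ : SimpleGraph (Fin (2 * r - 2)))
    (SimpleGraph.disjUnion (⊥ : SimpleGraph (Fin (2 * r - 3))) (⊤ : SimpleGraph (Fin 3)))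

/-- The graph `H := G_r ∨ K_{2t}`. -/
def Hrt (r t : ℕ) :
    SimpleGraph ((Fin (2 * r - 2) ⊕ (Fin (2 * r - 3) ⊕ Fin 3)) ⊕ Fin (2 * t)) :=
  SimpleGraph.join (Gr r) (⊤ : SimpleGraph (Fin (2 * t)))

instance (r : ℕ) : DecidableRel (Gr r).Adj := by unfold Gr; infer_instance
instance (r t : ℕ) : DecidableRel (Hrt r t).Adj := by unfold Hrt; infer_instance

theorem deg_sum {V : Type*} [Fintype V] (G : SimpleGraph V) [DecidableRel G.Adj] (v : V) :
    G.degree v = ∑ w, if G.Adj v w then 1 else 0 := by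
  rw [← SimpleGraph.card_neighborFinset_eq_degree, SimpleGraph.neighborFinset_eq_filter,
    Finset.card_filter]

theorem sum_ne_fin (n : ℕ) (a : Fin n) : (∑ b : Fin n, if a = b then 0 else 1) = n - 1 := by
  have h : (∑ b : Fin n, if a = b then 0 else 1) + (∑ b : Fin n, if a = b then 1 else 0) = n := by
    rw [← Finset.sum_add_distrib]
    rw [Finset.sum_congr rfl (g := fun _ => 1)]
    · simp
    · intro x _; split_ifs <;> rfl
  simp at h
  omega

theorem walk_weight {V : Type*} (G : SimpleGraph V) (w : V → ℕ)
    (h3 : ∀ u v, G.Adj u v → 3 ≤ w u + w v) {u v : V} (p : G.Walk u v) :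
    w u + w v + 3 * p.length ≤ 2 * (p.support.map w).sum := by
  induction p with
  | nil => simp; omega
  | cons h p ih =>
    have := h3 _ _ h
    simp
    omega

theorem cycle_weight {V : Type*} (G : SimpleGraph V) (w : V → ℕ)
    (h3 : ∀ u v, G.Adj u v → 3 ≤ w u + w v)
    (h6 : ∀ u v x, G.Adj u v → G.Adj v x → G.Adj x u → 6 ≤ w u + w v + w x)
    {u : V} (p : G.Walk u u) (hp : p.IsCycle) :
    6 ≤ (p.support.tail.map w).sum := by
  have hl := hp.three_le_length
  have hw := walk_weight G w h3 p
  have hs : (p.support.map w).sum = w u + (p.support.tail.map w).sum := by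
    rw [← List.sum_cons, ← List.map_cons, SimpleGraph.Walk.cons_tail_support]
  by_cases h4 : 4 ≤ p.length
  · omega
  · have hlen : p.length = 3 := by omega
    clear hw hs hp
    match p, hlen with
    | .cons a (.cons b (.cons c .nil)), _ =>
      have := h6 _ _ _ a b c
      simp
      omega

theorem disjoint_weight {V : Type*} [Fintype V] (G : SimpleGraph V) (w : V → ℕ)
    (h3 : ∀ u v, G.Adj u v → 3 ≤ w u + w v)
    (h6 : ∀ u v x, G.Adj u v → G.Adj v x → G.Adj x u → 6 ≤ w u + w v + w x)
    (k : ℕ) (h : G.HasNDisjointCycles k) : 6 * k ≤ ∑ v, w v := by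
  classical
  obtain ⟨f, hc, hd⟩ := h
  let S : Fin k → Finset V := fun i => (f i).2.support.tail.toFinset
  have hS : ∀ i, 6 ≤ ∑ v ∈ S i, w v := fun i => by
    rw [List.sum_toFinset _ (hc i).support_nodup]
    exact cycle_weight G w h3 h6 _ (hc i)
  have hdis : ((Finset.univ : Finset (Fin k)) : Set (Fin k)).PairwiseDisjoint S := by
    intro i _ j _ hij
    refine Finset.disjoint_left.2 fun v hv hv' => ?_
    exact hd i j hij v (List.mem_of_mem_tail (List.mem_toFinset.1 hv))
      (List.mem_of_mem_tail (List.mem_toFinset.1 hv'))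
  calc 6 * k = ∑ _i : Fin k, 6 := by simp [mul_comm]
    _ ≤ ∑ i, ∑ v ∈ S i, w v := Finset.sum_le_sum fun i _ => hS i
    _ = ∑ v ∈ Finset.univ.biUnion S, w v := (Finset.sum_biUnion hdis).symm
    _ ≤ ∑ v, w v := Finset.sum_le_sum_of_subset (Finset.subset_univ _)

/-- Weights 2, 1, 2, 3 on the four parts. -/
def wt (r t : ℕ) : ((Fin (2 * r - 2) ⊕ (Fin (2 * r - 3) ⊕ Fin 3)) ⊕ Fin (2 * t)) → ℕ
  | .inl (.inl _) => 2
  | .inl (.inr (.inl _)) => 1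
  | .inl (.inr (.inr _)) => 2
  | .inr _ => 3

/-- Clique cover with `2r-2` cliques. -/
def cliqueIdx (r t : ℕ) : ((Fin (2 * r - 2) ⊕ (Fin (2 * r - 3) ⊕ Fin 3)) ⊕ Fin (2 * t)) → ℕ
  | .inl (.inl i) => i
  | .inl (.inr (.inl i)) => i
  | .inl (.inr (.inr _)) => 2 * r - 3
  | .inr _ => 2 * r - 3

theorem no_cycles (r t : ℕ) (hr : 3 ≤ r) : ¬ (Hrt r t).HasNDisjointCycles (r + t) := by
  intro h
  have := disjoint_weight (Hrt r t) (wt r t) ?_ ?_ _ h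
  · simp [Fintype.sum_sum_type, wt] at this
    omega
  · rintro ((a | a | a) | a) ((b | b | b) | b) h <;>
      simp [Hrt, Gr, SimpleGraph.join, SimpleGraph.disjUnion, wt] at h ⊢
  · rintro ((a | a | a) | a) ((b | b | b) | b) ((c | c | c) | c) h h' h'' <;>
      simp [Hrt, Gr, SimpleGraph.join, SimpleGraph.disjUnion, wt] at h h' h'' ⊢

theorem min_deg (r t : ℕ) (hr : 3 ≤ r) : (Hrt r t).minDegree = 2 * (r + t) - 2 := by
  have key : ∀ v, 2 * (r + t) - 2 ≤ (Hrt r t).degree v := by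
    rintro ((a | a | a) | a) <;> rw [deg_sum] <;>
      simp [Fintype.sum_sum_type, Hrt, Gr, SimpleGraph.join, SimpleGraph.disjUnion, sum_ne_fin,
        -Finset.sum_boole] <;> omega
  have : Nonempty (Fin (2 * r - 3)) := ⟨⟨0, by omega⟩⟩
  let b : Fin (2 * r - 3) := ⟨0, by omega⟩
  apply le_antisymm
  · refine ((Hrt r t).minDegree_le_degree (.inl (.inr (.inl b)))).trans ?_
    rw [deg_sum]
    simp [Fintype.sum_sum_type, Hrt, Gr, SimpleGraph.join, SimpleGraph.disjUnion]
    omega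
  · exact (Hrt r t).le_minDegree_of_forall_le_degree _ key

theorem indep_num (r t : ℕ) (hr : 3 ≤ r) : (Hrt r t).indepNum' = 2 * r - 2 := by
  apply IsGreatest.csSup_eq
  constructor
  · refine ⟨Finset.univ.map ⟨fun i : Fin (2 * r - 2) => Sum.inl (Sum.inl i), ?_⟩, by simp, ?_⟩
    · intro i j h; simpa using h
    · intro v hv w hw _
      simp at hv hw
      obtain ⟨i, rfl⟩ := hv
      obtain ⟨j, rfl⟩ := hw
      intro h
      exact h
  · rintro n ⟨s, rfl, hs⟩
    have := Finset.card_le_card_of_injOn (s := s) (t := Finset.range (2 * r - 2))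
      (cliqueIdx r t) ?_ ?_
    · simpa using this
    · rintro ((a | a | a) | a) _ <;> simp [cliqueIdx] <;> omega
    · intro v hv w hw hvw
      by_contra hne
      have := hs v hv w hw hne
      clear hs hv hw
      revert hne this hvw
      rcases v with ((a | a | a) | a) <;> rcases w with ((b | b | b) | b) <;>
        simp [cliqueIdx, Hrt, Gr, SimpleGraph.join, SimpleGraph.disjUnion, Fin.ext_iff] <;> omega

/-- Let `k = r + t` with `k + 3 ≤ 2r ≤ 2k`. Then `H = G_r ∨ K_{2t}` has
`2k + 2r - 2 ≥ 3k + 1` vertices, minimum degree `2k - 2`, and independence number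
`2r - 2 = |H| - 2k`, but it does not contain `k` pairwise disjoint cycles. -/
theorem extremal_example_sigma_extended (r t k : ℕ) (hkrt : k = r + t)
    (hr1 : k + 3 ≤ 2 * r) (hr2 : 2 * r ≤ 2 * k) :
    Fintype.card ((Fin (2 * r - 2) ⊕ (Fin (2 * r - 3) ⊕ Fin 3)) ⊕ Fin (2 * t)) =
      2 * k + 2 * r - 2 ∧
    3 * k + 1 ≤ 2 * k + 2 * r - 2 ∧
    (Hrt r t).minDegree = 2 * k - 2 ∧
    (Hrt r t).indepNum' = 2 * r - 2 ∧
    2 * r - 2 =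
      Fintype.card ((Fin (2 * r - 2) ⊕ (Fin (2 * r - 3) ⊕ Fin 3)) ⊕ Fin (2 * t)) - 2 * k ∧
    ¬ (Hrt r t).HasNDisjointCycles k := by
  subst hkrt
  refine ⟨by simp; omega, by omega, min_deg r t (by omega), indep_num r t (by omega),
    by simp; omega, no_cycles r t (by omega)⟩
end

section
/- For all positive integers k₀ and n₀, the following two statements are equivalent: (A) for every k ≤ k₀ and every finite simple graph G with |G| ≤ n₀, χ(G) ≤ k, Δ(G) ≤ k, and no equitable k-coloring, k is odd and G contains K_{k,k} as a subgraph; (B) for every k ≤ k₀ and every finite simple graph G with |G| ≤ n₀, χ(G) ≤ k, and Δ(G) ≤ k, G has no equitable k-coloring if and only if k is odd and G is isomorphic to H + K_{k,k} for some k-equitable graph H. -/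
/-- `G` has an equitable `k`-coloring: a proper coloring with `k` colors in which any two
color classes differ in size by at most one. -/
def SimpleGraph.HasEquitableColoring {V : Type*} [Fintype V] (G : SimpleGraph V) (k : ℕ) :
    Prop :=
  ∃ C : G.Coloring (Fin k), ∀ i j : Fin k,
    (Finset.univ.filter fun v => C v = i).card ≤ (Finset.univ.filter fun v => C v = j).card + 1

/-- A graph `H` is `k`-equitable if `|H| = k * s` for some `s`, `χ(H) ≤ k`, and every proper
`k`-coloring of `H` has exactly `s` vertices in each color class. -/
def SimpleGraph.IsKEquitable {V : Type*} [Fintype V] (H : SimpleGraph V) (k : ℕ) : Prop :=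
  ∃ s : ℕ, Fintype.card V = k * s ∧ H.chromaticNumber ≤ k ∧
    ∀ C : H.Coloring (Fin k), ∀ i : Fin k, (Finset.univ.filter fun v => C v = i).card = s

set_option linter.all false
set_option linter.unusedSectionVars false
namespace EqCol

open Finset

section core

variable {V : Type} [Fintype V] {k : ℕ}

/-- neighbours of a vertex, as a finset -/
noncomputable def nb (G : SimpleGraph V) (v : V) : Finset V := by
  classical exact Finset.univ.filter (fun w => G.Adj v w)

lemma mem_nb {G : SimpleGraph V} {v w : V} : w ∈ nb G v ↔ G.Adj v w := by
  classical
  unfold nb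
  simp

/-- size of a colour class -/
def cls (g : V → Fin k) (c : Fin k) : ℕ := (Finset.univ.filter fun v => g v = c).card

/-- proper colouring -/
def Pr (G : SimpleGraph V) (g : V → Fin k) : Prop := ∀ a b, G.Adj a b → g a ≠ g b

/-- proper colouring with all classes of size `s` -/
def Eqb (G : SimpleGraph V) (s : ℕ) (g : V → Fin k) : Prop := Pr G g ∧ ∀ c, cls g c = s

/-- `G` has a nearly equitable colouring -/
def NE (G : SimpleGraph V) (k s : ℕ) : Prop :=
  ∃ g : V → Fin k, Pr G g ∧ ∃ i j, i ≠ j ∧ cls g i = s + 1 ∧ cls g j + 1 = s ∧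
    ∀ c, c ≠ i → c ≠ j → cls g c = s

/-- the standing assumptions -/
structure Ctx (G : SimpleGraph V) (k s : ℕ) : Prop where
  deg : ∀ v, (nb G v).card ≤ k
  cliq : ∀ T : Finset V, T.card = k → ¬ ∀ a ∈ T, ∀ b ∈ T, a ≠ b → G.Adj a b
  ne : ¬ NE G k s

lemma cls_perm (g : V → Fin k) (σ : Equiv.Perm V) (c : Fin k) : cls (g ∘ σ) c = cls g c := by
  unfold cls
  apply Finset.card_bij (fun v _ => σ v)
  · intro a ha; simpa using ha
  · intro a _ b _ h; exact σ.injective h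
  · intro b hb; exact ⟨σ.symm b, by simpa using hb, by simp⟩

variable [DecidableEq V]

lemma cls_update_new (g : V → Fin k) (v : V) (c : Fin k) (h : c ≠ g v) :
    cls (Function.update g v c) c = cls g c + 1 := by
  unfold cls
  have : (univ.filter fun w => Function.update g v c w = c)
      = insert v (univ.filter fun w => g w = c) := by
    ext w
    by_cases hw : w = v
    · subst hw; simp
    · simp [hw]
  rw [this, card_insert_of_notMem]
  simpa using h.symm

lemma cls_update_old (g : V → Fin k) (v : V) (c : Fin k) (h : c ≠ g v) :
    cls (Function.update g v c) (g v) + 1 = cls g (g v) := by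
  unfold cls
  have : (univ.filter fun w => g w = g v)
      = insert v (univ.filter fun w => Function.update g v c w = g v) := by
    ext w
    by_cases hw : w = v
    · subst hw; simp
    · simp [hw]
  rw [this, card_insert_of_notMem]
  simpa using h

lemma cls_update_other (g : V → Fin k) (v : V) (c d : Fin k) (h : d ≠ c) (h' : d ≠ g v) :
    cls (Function.update g v c) d = cls g d := by
  unfold cls
  congr 1
  ext w
  by_cases hw : w = v
  · subst hw; simp [h.symm, h'.symm]
  · simp [hw]

lemma ne_of_update {G : SimpleGraph V} {s : ℕ} (g : V → Fin k) (hg : ∀ c, cls g c = s) (v : V)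
    (c : Fin k) (h : c ≠ g v) (hp : Pr G (Function.update g v c)) : NE G k s := by
  refine ⟨_, hp, c, g v, h, ?_, ?_, ?_⟩
  · rw [cls_update_new g v c h, hg]
  · rw [cls_update_old g v c h, hg]
  · intro d hd hd'
    rw [cls_update_other g v c d hd hd', hg]

variable {G : SimpleGraph V} {s : ℕ} {g : V → Fin k}

lemma rigid (X : Ctx G k s) (hg : Eqb G s g) (v : V) (c : Fin k) (h : c ≠ g v) :
    ∃ w, G.Adj v w ∧ g w = c := by
  by_contra hcon
  push Not at hcon
  apply X.ne
  apply ne_of_update g hg.2 v c h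
  intro a b hab
  by_cases ha : a = v
  · subst ha
    have hb : b ≠ a := hab.ne.symm
    simp only [Function.update_self, Function.update_of_ne hb]
    exact (hcon b hab).symm
  · by_cases hb : b = v
    · subst hb
      simp only [Function.update_self, Function.update_of_ne ha]
      exact hcon a hab.symm
    · simp only [Function.update_of_ne ha, Function.update_of_ne hb]
      exact hg.1 a b hab

/-- the edge `xz` is a Kempe component -/
def Sw (G : SimpleGraph V) (g : V → Fin k) (x z : V) : Prop :=
  G.Adj x z ∧ (∀ w, G.Adj x w → g w = g z → w = z) ∧ (∀ w, G.Adj z w → g w = g x → w = x)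

/-- `x` is the only neighbour of `b` coloured like `x` -/
def Solo (G : SimpleGraph V) (g : V → Fin k) (x b : V) : Prop :=
  G.Adj x b ∧ ∀ w, G.Adj b w → g w = g x → w = x

/-- `b` has another neighbour coloured like `x` -/
def Dbl (G : SimpleGraph V) (g : V → Fin k) (x b : V) : Prop :=
  G.Adj x b ∧ ∃ w, G.Adj b w ∧ w ≠ x ∧ g w = g x

lemma Sw.symm {x z : V} (h : Sw G g x z) : Sw G g z x := ⟨h.1.symm, h.2.2, h.2.1⟩

lemma Sw.solo {x z : V} (h : Sw G g x z) : Solo G g x z := ⟨h.1, h.2.2⟩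

lemma not_dbl {x b : V} (h : G.Adj x b) : ¬ Dbl G g x b ↔ Solo G g x b := by
  unfold Dbl Solo
  constructor
  · intro h1
    refine ⟨h, fun w hw hc => ?_⟩
    by_contra hne
    exact h1 ⟨h, w, hw, hne, hc⟩
  · rintro ⟨_, h1⟩ ⟨_, w, hw, hne, hc⟩
    exact hne (h1 w hw hc)

lemma swap_eqb (hg : Eqb G s g) {x z : V} (h : Sw G g x z) : Eqb G s (g ∘ Equiv.swap x z) := by
  refine ⟨?_, fun c => by rw [cls_perm]; exact hg.2 c⟩
  obtain ⟨hxz, h1, h2⟩ := h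
  have key : ∀ a b, G.Adj a b → a = x → g (Equiv.swap x z a) ≠ g (Equiv.swap x z b) := by
    rintro a b hab rfl
    by_cases hb : b = z
    · subst hb; simpa using (hg.1 _ _ hab).symm
    · rw [Equiv.swap_apply_left, Equiv.swap_apply_of_ne_of_ne hab.ne.symm hb]
      intro he
      exact hb (h1 b hab he.symm)
  have key2 : ∀ a b, G.Adj a b → a = z → g (Equiv.swap x z a) ≠ g (Equiv.swap x z b) := by
    rintro a b hab rfl
    by_cases hb : b = x
    · subst hb; simpa using (hg.1 _ _ hab).symm
    · rw [Equiv.swap_apply_right, Equiv.swap_apply_of_ne_of_ne hb hab.ne.symm]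
      intro he
      exact hb (h2 b hab he.symm)
  intro a b hab
  simp only [Function.comp]
  by_cases ha : a = x
  · exact key a b hab ha
  by_cases ha' : a = z
  · exact key2 a b hab ha'
  by_cases hb : b = x
  · exact (key b a hab.symm hb).symm
  by_cases hb' : b = z
  · exact (key2 b a hab.symm hb').symm
  rw [Equiv.swap_apply_of_ne_of_ne ha ha', Equiv.swap_apply_of_ne_of_ne hb hb']
  exact hg.1 a b hab

lemma adj_of_sw (X : Ctx G k s) (hg : Eqb G s g) {x z b : V} (h : Sw G g x z)
    (hb : Solo G g x b) (hne : b ≠ z) : G.Adj z b := by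
  have hg' := swap_eqb hg h
  have hbx : b ≠ x := hb.1.ne.symm
  have e1 : (g ∘ Equiv.swap x z) b = g b := by
    simp [Function.comp, Equiv.swap_apply_of_ne_of_ne hbx hne]
  obtain ⟨w, hw, hc⟩ := rigid X hg' b (g x) (by rw [e1]; exact hg.1 _ _ hb.1)
  simp only [Function.comp] at hc
  by_cases h1 : w = x
  · subst h1
    rw [Equiv.swap_apply_left] at hc
    exact absurd hc.symm (hg.1 _ _ h.1)
  by_cases h2 : w = z
  · subst h2; exact hw.symm
  rw [Equiv.swap_apply_of_ne_of_ne h1 h2] at hc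
  exact absurd (hb.2 w hw hc) h1

/-- three vertex Kempe components are impossible -/
lemma no_three (X : Ctx G k s) (hg : Eqb G s g) {x u w : V} (huw : u ≠ w) (hc : g u = g w)
    (hp : ∀ y, G.Adj x y → g y = g u → y = u ∨ y = w)
    (hu : Solo G g x u) (hw : Solo G g x w) : False := by
  apply X.ne
  have hux : u ≠ x := hu.1.ne.symm
  have hwx : w ≠ x := hw.1.ne.symm
  have hgw : (g ∘ Equiv.swap u x) w = g w := by
    simp [Function.comp, Equiv.swap_apply_of_ne_of_ne huw.symm hwx]
  have hxu := hg.1 _ _ hu.1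
  apply ne_of_update (g ∘ Equiv.swap u x) (fun c => by rw [cls_perm]; exact hg.2 c) w (g x)
  · rw [hgw, ← hc]; exact hxu
  set g' := Function.update (g ∘ Equiv.swap u x) w (g x) with hg'
  have eu : g' u = g x := by
    rw [hg', Function.update_of_ne huw]; simp
  have ew : g' w = g x := by rw [hg']; simp
  have ex : g' x = g u := by
    rw [hg', Function.update_of_ne hwx.symm]; simp
  have eo : ∀ y, y ≠ u → y ≠ x → y ≠ w → g' y = g y := by
    intro y h1 h2 h3
    rw [hg', Function.update_of_ne h3]; simp [Equiv.swap_apply_of_ne_of_ne h1 h2]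
  have kx : ∀ b, G.Adj x b → g' x ≠ g' b := by
    intro b hb
    rw [ex]
    by_cases h1 : b = u
    · rw [h1, eu]; exact hxu.symm
    by_cases h2 : b = w
    · rw [h2, ew]; exact hxu.symm
    rw [eo b h1 hb.ne.symm h2]
    intro he
    rcases hp b hb he.symm with h | h
    · exact h1 h
    · exact h2 h
  have ku : ∀ a b, G.Adj a b → (a = u ∨ a = w) → b ≠ x → g' a ≠ g' b := by
    intro a b hab ha hbx
    have e1 : g' a = g x := by rcases ha with rfl | rfl <;> assumption
    have e2 : g a = g u := by rcases ha with rfl | rfl; rfl; exact hc.symm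
    have hsol : ∀ y, G.Adj a y → g y = g x → y = x := by
      rcases ha with rfl | rfl
      · exact hu.2
      · exact hw.2
    have hb1 : b ≠ u := by
      rintro rfl; exact hg.1 _ _ hab e2
    have hb2 : b ≠ w := by
      rintro rfl; exact hg.1 _ _ hab (e2.trans hc)
    rw [e1, eo b hb1 hbx hb2]
    intro he
    exact hbx (hsol b hab he.symm)
  intro a b hab
  by_cases ha : a = x
  · subst ha; exact kx b hab
  by_cases hb : b = x
  · subst hb; exact (kx a hab.symm).symm
  by_cases ha' : a = u ∨ a = w
  · exact ku a b hab ha' hb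
  by_cases hb' : b = u ∨ b = w
  · exact (ku b a hab.symm hb' ha).symm
  push Not at ha' hb'
  rw [eo a ha'.1 ha ha'.2, eo b hb'.1 hb hb'.2]
  exact hg.1 a b hab

end core
end EqCol
namespace EqCol

open Finset

section str

variable {V : Type} [Fintype V] [DecidableEq V] {k : ℕ}
variable {G : SimpleGraph V} {s : ℕ} {g : V → Fin k}

/-- `u, w` are the two neighbours of `x` sharing a colour -/
structure Pair (G : SimpleGraph V) (g : V → Fin k) (x u w : V) : Prop where
  ne : u ≠ w
  au : G.Adj x u
  aw : G.Adj x w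
  col : g u = g w
  only : ∀ y y', G.Adj x y → G.Adj x y' → g y = g y' → y ≠ y' →
    (y = u ∧ y' = w) ∨ (y = w ∧ y' = u)

lemma Pair.uniq {x u w y : V} (P : Pair G g x u w) (hy : G.Adj x y) (hu : y ≠ u) (hw : y ≠ w) :
    ∀ y', G.Adj x y' → g y' = g y → y' = y := by
  intro y' h1 h2
  by_contra hne
  rcases P.only y' y h1 hy h2 hne with h | h
  · exact hw h.2
  · exact hu h.2

lemma Pair.swap {x u w : V} (P : Pair G g x u w) : Pair G g x w u :=
  ⟨P.ne.symm, P.aw, P.au, P.col.symm, fun y y' a b c d => (P.only y y' a b c d).symm⟩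

lemma image_nb (X : Ctx G k s) (hg : Eqb G s g) (x : V) :
    (nb G x).image g = univ.erase (g x) := by
  ext c
  simp only [mem_image, mem_nb, mem_erase, mem_univ, and_true]
  constructor
  · rintro ⟨y, hy, rfl⟩; exact (hg.1 _ _ hy).symm
  · intro h; exact rigid X hg x c h

lemma card_image_nb (X : Ctx G k s) (hg : Eqb G s g) (x : V) :
    ((nb G x).image g).card = k - 1 := by
  rw [image_nb X hg, card_erase_of_mem (mem_univ _)]; simp

lemma exists_pair (X : Ctx G k s) (hg : Eqb G s g) (x : V) (hc : (nb G x).card = k) :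
    ∃ u w, Pair G g x u w := by
  have hk : 0 < k := (g x).pos
  have hci := card_image_nb X hg x
  have hni : ¬ Set.InjOn g (nb G x) := by
    intro hi
    rw [card_image_of_injOn hi] at hci
    omega
  unfold Set.InjOn at hni
  push Not at hni
  obtain ⟨u, hu, w, hw, hgu, hne⟩ := hni
  have hu' : G.Adj x u := mem_nb.1 hu
  have hw' : G.Adj x w := mem_nb.1 hw
  refine ⟨u, w, hne, hu', hw', hgu, ?_⟩
  have him : ((nb G x).erase w).image g = (nb G x).image g := by
    ext c
    simp only [mem_image, mem_erase]
    constructor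
    · rintro ⟨y, hy, rfl⟩; exact ⟨y, hy.2, rfl⟩
    · rintro ⟨y, hy, rfl⟩
      by_cases h : y = w
      · exact ⟨u, ⟨hne, hu⟩, by rw [h, hgu]⟩
      · exact ⟨y, ⟨h, hy⟩, rfl⟩
  have hinj : Set.InjOn g ((nb G x).erase w) := by
    rw [← card_image_iff, him, hci, card_erase_of_mem hw, hc]
  have hinj' : ∀ y y', G.Adj x y → y ≠ w → G.Adj x y' → y' ≠ w → g y = g y' → y = y' := by
    intro y y' h1 h2 h3 h4 h5
    exact hinj (by simp [mem_nb, h1, h2]) (by simp [mem_nb, h3, h4]) h5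
  intro y y' h1 h2 h3 h4
  by_cases h5 : y = w
  · right
    refine ⟨h5, ?_⟩
    subst h5
    exact hinj' y' u h2 h4.symm hu' hne (by rw [← h3, hgu])
  · by_cases h6 : y' = w
    · left
      refine ⟨?_, h6⟩
      subst h6
      exact hinj' y u h1 h5 hu' hne (by rw [h3, hgu])
    · exact absurd (hinj' y y' h1 h5 h2 h6 h3) h4

lemma no_star_clique (X : Ctx G k s) (hg : Eqb G s g) (x u : V) (S : Finset V)
    (hc : S.card = k - 1) (hS : ∀ y ∈ S, Solo G g x y ∧ (y ≠ u → Sw G g x y)) : False := by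
  have hk : 0 < k := (g x).pos
  have hx : x ∉ S := fun h => (hS x h).1.1.ne rfl
  apply X.cliq (insert x S) (by rw [card_insert_of_notMem hx, hc]; omega)
  have key : ∀ a ∈ S, ∀ b ∈ S, a ≠ b → a ≠ u → G.Adj a b := by
    intro a ha b hb hab hau
    exact adj_of_sw X hg ((hS a ha).2 hau) (hS b hb).1 hab.symm
  intro a ha b hb hab
  rw [mem_insert] at ha hb
  rcases ha with rfl | ha
  · rcases hb with rfl | hb
    · exact absurd rfl hab
    · exact (hS b hb).1.1
  · rcases hb with rfl | hb
    · exact (hS a ha).1.1.symm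
    · by_cases h : a = u
      · refine (key b hb a ha hab.symm ?_).symm
        rw [← h]; exact hab.symm
      · exact key a ha b hb hab h

/-- doubled neighbours -/
noncomputable def dset (G : SimpleGraph V) (g : V → Fin k) (x : V) : Finset V := by
  classical exact Finset.univ.filter (fun b => Dbl G g x b)

lemma mem_dset {x b : V} : b ∈ dset G g x ↔ Dbl G g x b := by
  classical
  unfold dset; simp

noncomputable def mset (G : SimpleGraph V) (g : V → Fin k) (b : V) : Finset V := by
  classical exact Finset.univ.filter (fun x => Dbl G g x b)

lemma mem_mset {x b : V} : x ∈ mset G g b ↔ Dbl G g x b := by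
  classical
  unfold mset; simp

lemma sum_dset : ∑ x, (dset G g x).card = ∑ b, (mset G g b).card := by
  classical
  have := Finset.sum_card_bipartiteAbove_eq_sum_card_bipartiteBelow (s := (univ : Finset V))
    (t := (univ : Finset V)) (Dbl G g)
  convert this using 3
  · ext y; simp [mem_dset, Finset.bipartiteAbove]
  · ext y; simp [mem_mset, Finset.bipartiteBelow]

lemma deg_or (X : Ctx G k s) (hg : Eqb G s g) (x : V) :
    (nb G x).card = k - 1 ∨ (nb G x).card = k := by
  have h1 := X.deg x
  have h2 := card_image_nb X hg x
  have h3 : ((nb G x).image g).card ≤ (nb G x).card := card_image_le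
  omega

lemma inj_of_small (X : Ctx G k s) (hg : Eqb G s g) (x : V) (h : (nb G x).card = k - 1) :
    ∀ y y', G.Adj x y → G.Adj x y' → g y = g y' → y = y' := by
  have h2 := card_image_nb X hg x
  rw [← h, card_image_iff] at h2
  intro y y' h3 h4 h5
  exact h2 (by simpa [mem_nb] using h3) (by simpa [mem_nb] using h4) h5

lemma mset_small (X : Ctx G k s) (hg : Eqb G s g) (x : V) (h : (nb G x).card = k - 1) :
    (mset G g x).card = 0 := by
  rw [card_eq_zero, eq_empty_iff_forall_notMem]
  intro y hy
  obtain ⟨h1, w, h2, h3, h4⟩ := mem_mset.1 hy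
  exact h3 (inj_of_small X hg x h w y h2 h1.symm h4)

lemma mset_pair {x u w : V} (P : Pair G g x u w) : (mset G g x).card = 2 := by
  have : mset G g x = {u, w} := by
    ext y
    rw [mem_mset, mem_insert, mem_singleton]
    constructor
    · rintro ⟨h1, w', h2, h3, h4⟩
      rcases P.only y w' h1.symm h2 h4.symm h3.symm with h | h
      · exact Or.inl h.1
      · exact Or.inr h.1
    · rintro (rfl | rfl)
      · exact ⟨P.au.symm, w, P.aw, P.ne.symm, P.col.symm⟩
      · exact ⟨P.aw.symm, u, P.au, P.ne, P.col⟩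
  rw [this, card_pair P.ne]

lemma Pair.sw {x u w y : V} (P : Pair G g x u w) (hy : G.Adj x y) (hu : y ≠ u) (hw : y ≠ w)
    (hs : Solo G g x y) : Sw G g x y := ⟨hy, P.uniq hy hu hw, hs.2⟩

lemma dset_small (X : Ctx G k s) (hg : Eqb G s g) (x : V) (h : (nb G x).card = k - 1) :
    1 ≤ (dset G g x).card := by
  by_contra hcon
  have h0 : dset G g x = ∅ := by rw [← card_eq_zero]; omega
  apply no_star_clique X hg x x (nb G x) h
  intro y hy
  have hy' := mem_nb.1 hy
  have hs : Solo G g x y := by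
    rw [← not_dbl hy', ← mem_dset, h0]; simp
  exact ⟨hs, fun _ => ⟨hy', fun w hw hc => inj_of_small X hg x h w y hw hy' hc, hs.2⟩⟩

lemma Pair.no_clique (X : Ctx G k s) (hg : Eqb G s g) {x u w : V} (P : Pair G g x u w)
    (hc : (nb G x).card = k) (h : ∀ y, Dbl G g x y → y = w) : False := by
  apply no_star_clique X hg x u ((nb G x).erase w)
    (by rw [card_erase_of_mem (mem_nb.2 P.aw), hc])
  intro y hy
  rw [mem_erase, mem_nb] at hy
  have hs : Solo G g x y := by
    rw [← not_dbl hy.2]; exact fun hd => hy.1 (h y hd)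
  exact ⟨hs, fun hu => P.sw hy.2 hu hy.1 hs⟩

lemma Pair.dbl (X : Ctx G k s) (hg : Eqb G s g) {x u w : V} (P : Pair G g x u w) :
    Dbl G g x u ∨ Dbl G g x w := by
  by_contra hcon
  push Not at hcon
  rw [not_dbl P.au, not_dbl P.aw] at hcon
  refine no_three X hg P.ne P.col ?_ hcon.1 hcon.2
  intro y hy hc
  by_contra hn
  push Not at hn
  exact hn.1 (P.uniq hy hn.1 hn.2 u P.au hc.symm).symm

lemma dset_big (X : Ctx G k s) (hg : Eqb G s g) {x u w : V} (P : Pair G g x u w)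
    (hc : (nb G x).card = k) : 2 ≤ (dset G g x).card := by
  wlog hd : Dbl G g x w generalizing u w
  · exact this P.swap ((P.dbl X hg).resolve_right hd)
  by_contra hcon
  apply P.no_clique X hg hc
  intro y hy
  exact Finset.card_le_one.1 (by omega) y (mem_dset.2 hy) w (mem_dset.2 hd)

lemma all_k (X : Ctx G k s) (hg : Eqb G s g) (x : V) :
    (nb G x).card = k ∧ (dset G g x).card = 2 := by
  have hle : ∀ x ∈ univ, (mset G g x).card ≤ (dset G g x).card := by
    intro x _
    rcases deg_or X hg x with h | h
    · rw [mset_small X hg x h]; omega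
    · obtain ⟨u, w, P⟩ := exists_pair X hg x h
      rw [mset_pair P]; exact dset_big X hg P h
  have heq := (Finset.sum_eq_sum_iff_of_le hle).1 (sum_dset (G := G) (g := g)).symm x (mem_univ _)
  rcases deg_or X hg x with h | h
  · rw [mset_small X hg x h] at heq
    have := dset_small X hg x h
    omega
  · obtain ⟨u, w, P⟩ := exists_pair X hg x h
    rw [mset_pair P] at heq
    exact ⟨h, heq.symm⟩

/-- both members of the double pair are doubled -/
structure IsC (G : SimpleGraph V) (g : V → Fin k) (x u w : V) : Prop where
  pair : Pair G g x u w
  du : Dbl G g x u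
  dw : Dbl G g x w
  sw : ∀ y, G.Adj x y → y ≠ u → y ≠ w → Sw G g x y

/-- one member of the double pair is doubled -/
structure IsB (G : SimpleGraph V) (g : V → Fin k) (x u w t : V) : Prop where
  pair : Pair G g x u w
  su : Solo G g x u
  dw : Dbl G g x w
  dt : Dbl G g x t
  tu : t ≠ u
  tw : t ≠ w
  sw : ∀ y, G.Adj x y → y ≠ u → y ≠ w → y ≠ t → Sw G g x y

theorem str (X : Ctx G k s) (hg : Eqb G s g) (x : V) :
    (∃ u w, IsC G g x u w) ∨ (∃ u w t, IsB G g x u w t) := by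
  obtain ⟨hk, hd⟩ := all_k X hg x
  obtain ⟨u, w, P⟩ := exists_pair X hg x hk
  wlog hw : Dbl G g x w generalizing u w
  · exact this w u P.swap ((P.dbl X hg).resolve_right hw)
  by_cases hu : Dbl G g x u
  · left
    refine ⟨u, w, P, hu, hw, ?_⟩
    intro y hy h1 h2
    apply P.sw hy h1 h2
    rw [← not_dbl hy]
    intro hdy
    have hsub : ({y, u, w} : Finset V) ⊆ dset G g x := by
      intro z; simp only [mem_insert, mem_singleton, mem_dset]
      rintro (rfl | rfl | rfl) <;> assumption
    have := card_le_card hsub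
    rw [hd, card_eq_three.2 ⟨y, u, w, h1, h2, P.ne, rfl⟩] at this
    omega
  · right
    have : ∃ t ∈ dset G g x, t ≠ w := Finset.exists_mem_ne (by omega) w
    obtain ⟨t, ht, htw⟩ := this
    have ht := mem_dset.1 ht
    have htu : t ≠ u := by rintro rfl; exact hu ht
    refine ⟨u, w, t, P, (not_dbl P.au).1 hu, hw, ht, htu, htw, ?_⟩
    intro y hy h1 h2 h3
    apply P.sw hy h1 h2
    rw [← not_dbl hy]
    intro hdy
    have hsub : ({y, t, w} : Finset V) ⊆ dset G g x := by
      intro z; simp only [mem_insert, mem_singleton, mem_dset]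
      rintro (rfl | rfl | rfl) <;> assumption
    have := card_le_card hsub
    rw [hd, card_eq_three.2 ⟨y, t, w, h3, h2, htw, rfl⟩] at this
    omega

lemma Pair.same {x u w u' w' : V} (P : Pair G g x u w) (P' : Pair G g x u' w') :
    (u' = u ∧ w' = w) ∨ (u' = w ∧ w' = u) := P.only u' w' P'.au P'.aw P'.col P'.ne

lemma dbl_of_two {x y z : V} (h1 : G.Adj x y) (h2 : G.Adj x z) (hc : g y = g z) (hne : y ≠ z) :
    Dbl G g y x := ⟨h1.symm, z, h2, hne.symm, hc.symm⟩

lemma not_solo_dbl {x b : V} (h : Solo G g x b) (h' : Dbl G g x b) : False :=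
  (not_dbl h.1).2 h h'

lemma IsB.prev (X : Ctx G k s) (hg : Eqb G s g) {x u w t : V} (B : IsB G g x u w t) :
    ∃ u' w', IsB G g u u' w' x := by
  have hd : Dbl G g u x := dbl_of_two B.pair.au B.pair.aw B.pair.col B.pair.ne
  have key : ∀ a b, Pair G g u a b → x ≠ a ∧ x ≠ b := by
    intro a b P
    constructor
    · rintro rfl
      exact P.ne (B.su.2 b P.aw P.col.symm).symm
    · rintro rfl
      exact P.ne (B.su.2 a P.au P.col)
  rcases str X hg u with ⟨a, b, C⟩ | ⟨a, b, c, C⟩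
  · obtain ⟨h1, h2⟩ := key a b C.pair
    exact (not_solo_dbl (C.sw x B.pair.au.symm h1 h2).solo hd).elim
  · obtain ⟨h1, h2⟩ := key a b C.pair
    by_cases h3 : x = c
    · subst h3; exact ⟨a, b, C⟩
    · exact (not_solo_dbl (C.sw x B.pair.au.symm h1 h2 h3).solo hd).elim

lemma IsB.next (X : Ctx G k s) (hg : Eqb G s g) {x u w t : V} (B : IsB G g x u w t) :
    ∃ w' t', IsB G g t x w' t' := by
  obtain ⟨ha, y, hy, hne, hc⟩ := B.dt
  have hs : Solo G g t x := ⟨ha.symm, B.pair.uniq ha B.tu B.tw⟩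
  have hnd : ¬ Dbl G g t x := fun h => not_solo_dbl hs h
  rcases str X hg t with ⟨a, b, C⟩ | ⟨a, b, c, C⟩
  · rcases C.pair.only x y ha.symm hy hc.symm hne.symm with h | h
    · rw [h.1] at hnd; exact (hnd C.du).elim
    · rw [h.1] at hnd; exact (hnd C.dw).elim
  · rcases C.pair.only x y ha.symm hy hc.symm hne.symm with h | h
    · rw [h.1]; exact ⟨b, c, C⟩
    · rw [h.1] at hnd; exact (hnd C.dw).elim

lemma IsB.uniq {x u w t u' w' t' : V} (B : IsB G g x u w t) (B' : IsB G g x u' w' t') :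
    u' = u ∧ w' = w ∧ t' = t := by
  have h1 : u' = u ∧ w' = w := by
    rcases B.pair.same B'.pair with h | h
    · exact h
    · have := B'.su
      rw [h.1] at this
      exact (not_solo_dbl this B.dw).elim
  refine ⟨h1.1, h1.2, ?_⟩
  by_contra hne
  have h2 := B'.tu
  have h3 := B'.tw
  rw [h1.1] at h2
  rw [h1.2] at h3
  exact not_solo_dbl (B.sw t' B'.dt.1 h2 h3 hne).solo B'.dt

lemma IsB.not_C {x u w t u' w' : V} (B : IsB G g x u w t) (C : IsC G g x u' w') : False := by
  rcases C.pair.same B.pair with h | h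
  · have := C.du; rw [← h.1] at this; exact not_solo_dbl B.su this
  · have := C.dw; rw [← h.1] at this; exact not_solo_dbl B.su this

end str
end EqCol
namespace EqCol

open Finset

section noB

variable {V : Type} [Fintype V] [DecidableEq V] {k : ℕ}
variable {G : SimpleGraph V} {s : ℕ} {g : V → Fin k}

lemma IsC.swap {x u w : V} (C : IsC G g x u w) : IsC G g x w u :=
  ⟨C.pair.swap, C.dw, C.du, fun y h1 h2 h3 => C.sw y h1 h3 h2⟩

lemma IsC.mem_of_dbl {x u w y : V} (C : IsC G g x u w) (h : Dbl G g x y) : y = u ∨ y = w := by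
  by_contra hn
  push Not at hn
  exact not_solo_dbl (C.sw y h.1 hn.1 hn.2).solo h

/-- a second switchable edge in the same two colours stays switchable -/
lemma Sw.after (hg : Pr G g) {a b c d : V} (h1 : Sw G g a b) (h2 : Sw G g c d)
    (hac : g a = g c) (hbd : g b = g d) (hne : a ≠ c) (hne' : b ≠ d) :
    Sw G (g ∘ Equiv.swap a b) c d := by
  have hcb : c ≠ b := by
    rintro rfl; exact hg _ _ h1.1 hac
  have hda : d ≠ a := by
    rintro rfl; exact hg _ _ h2.1 hac.symm
  have ec : (g ∘ Equiv.swap a b) c = g c := by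
    simp [Equiv.swap_apply_of_ne_of_ne hne.symm hcb]
  have ed : (g ∘ Equiv.swap a b) d = g d := by
    simp [Equiv.swap_apply_of_ne_of_ne hda hne'.symm]
  refine ⟨h2.1, ?_, ?_⟩
  · intro w hw hc
    rw [ed] at hc
    by_cases e1 : w = a
    · subst e1; exact (hg _ _ hw hac.symm).elim
    by_cases e2 : w = b
    · subst e2
      simp only [Function.comp, Equiv.swap_apply_right] at hc
      have := hg _ _ h2.1
      rw [← hc, hac] at this
      exact (this rfl).elim
    simp only [Function.comp, Equiv.swap_apply_of_ne_of_ne e1 e2] at hc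
    exact h2.2.1 w hw hc
  · intro w hw hc
    rw [ec] at hc
    by_cases e1 : w = a
    · subst e1
      simp only [Function.comp, Equiv.swap_apply_left] at hc
      have := hg _ _ h2.1
      rw [← hc, hbd] at this
      exact (this rfl).elim
    by_cases e2 : w = b
    · subst e2
      exact (hg _ _ hw hbd.symm).elim
    simp only [Function.comp, Equiv.swap_apply_of_ne_of_ne e1 e2] at hc
    exact h2.2.2 w hw hc

/-- the `c`-coloured switchable partner -/
lemma IsC.partner (X : Ctx G k s) (hg : Eqb G s g) {x u w : V} (C : IsC G g x u w) (c : Fin k)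
    (h1 : c ≠ g x) (h2 : c ≠ g u) : ∃ y, Sw G g x y ∧ g y = c := by
  obtain ⟨y, hy, hc⟩ := rigid X hg x c h1
  refine ⟨y, C.sw y hy ?_ ?_, hc⟩
  · rintro rfl; exact h2 hc.symm
  · rintro rfl; exact h2 (hc.symm.trans C.pair.col.symm)

lemma IsC.cover (X : Ctx G k s) (hg : Eqb G s g) {x u w a b a' b' z : V} (C : IsC G g x u w)
    (Cu : IsC G g u a b) (Cw : IsC G g w a' b') (hz : G.Adj x z) (hzu : z ≠ u) (hzw : z ≠ w) :
    Sw G g u z ∨ Sw G g w z := by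
  have hsz := C.sw z hz hzu hzw
  have hlx : g z ≠ g x := (hg.1 _ _ hz).symm
  have hlu : g z ≠ g u := by
    intro h
    exact hzu (C.pair.uniq hz hzu hzw u C.pair.au h.symm).symm
  have e1 : g a = g x := by
    have : Dbl G g u x := dbl_of_two C.pair.au C.pair.aw C.pair.col C.pair.ne
    rcases Cu.mem_of_dbl this with rfl | rfl
    · rfl
    · exact Cu.pair.col
  have e2 : g a' = g x := by
    have : Dbl G g w x := dbl_of_two C.pair.aw C.pair.au C.pair.col.symm C.pair.ne.symm
    rcases Cw.mem_of_dbl this with rfl | rfl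
    · rfl
    · exact Cw.pair.col
  obtain ⟨yu, hyu, cyu⟩ := Cu.partner X hg (g z) hlu (by rw [e1]; exact hlx)
  obtain ⟨yw, hyw, cyw⟩ := Cw.partner X hg (g z) (by rw [← C.pair.col]; exact hlu)
    (by rw [e2]; exact hlx)
  by_cases h1 : yu = z
  · left; rw [← h1]; exact hyu
  by_cases h2 : yw = z
  · right; rw [← h2]; exact hyw
  exfalso
  have hyy : yu ≠ yw := by
    rintro rfl
    exact C.pair.ne (hyu.2.2 w hyw.1.symm C.pair.col.symm).symm
  have hs1 := swap_eqb hg hyu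
  have hs2 := swap_eqb hs1 (Sw.after hg.1 hyu hyw C.pair.col (cyu.trans cyw.symm) C.pair.ne hyy)
  have hxu : x ≠ u := C.pair.au.ne
  have hxw : x ≠ w := C.pair.aw.ne
  have hxyu : x ≠ yu := by rintro rfl; exact hlx cyu.symm
  have hxyw : x ≠ yw := by rintro rfl; exact hlx cyw.symm
  have hnu : ¬ G.Adj x yu := fun h => h1 (C.pair.uniq hz hzu hzw yu h cyu)
  have hnw : ¬ G.Adj x yw := fun h => h2 (C.pair.uniq hz hzu hzw yw h cyw)
  have huyw : u ≠ yw := by rintro rfl; exact hlu cyw.symm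
  have hwyu : w ≠ yu := by rintro rfl; exact hlu (by rw [← cyu, C.pair.col])
  obtain ⟨q, hq, hc⟩ := rigid X hs2 x (g u) (by
    simp only [Function.comp]
    rw [Equiv.swap_apply_of_ne_of_ne hxw hxyw, Equiv.swap_apply_of_ne_of_ne hxu hxyu]
    exact (hg.1 _ _ C.pair.au).symm)
  have hqyu : q ≠ yu := by rintro rfl; exact hnu hq
  have hqyw : q ≠ yw := by rintro rfl; exact hnw hq
  simp only [Function.comp] at hc
  by_cases k1 : q = w
  · subst k1
    rw [Equiv.swap_apply_left, Equiv.swap_apply_of_ne_of_ne huyw.symm hyy.symm, cyw] at hc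
    exact hlu hc
  rw [Equiv.swap_apply_of_ne_of_ne k1 hqyw] at hc
  by_cases k2 : q = u
  · subst k2
    rw [Equiv.swap_apply_left, cyu] at hc
    exact hlu hc
  rw [Equiv.swap_apply_of_ne_of_ne k2 hqyu] at hc
  exact k2 (C.pair.uniq hq k2 k1 u C.pair.au hc.symm).symm

/-- the switchable neighbours -/
noncomputable def sset (G : SimpleGraph V) (x u w : V) : Finset V := ((nb G x).erase u).erase w

lemma mem_sset {x u w y : V} : y ∈ sset G x u w ↔ y ≠ w ∧ y ≠ u ∧ G.Adj x y := by
  simp [sset, mem_nb]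

lemma card_sset {x u w : V} (hk : (nb G x).card = k) (h1 : G.Adj x u) (h2 : G.Adj x w)
    (h : u ≠ w) : (sset G x u w).card = k - 2 := by
  unfold sset
  rw [card_erase_of_mem, card_erase_of_mem (mem_nb.2 h1), hk]
  · omega
  · rw [mem_erase, mem_nb]; exact ⟨h.symm, h2⟩

open Classical in
lemma IsC.half (X : Ctx G k s) (hg : Eqb G s g) {x u w b z : V} (C : IsC G g x u w)
    (Cu : IsC G g u x b) (hz : z ∈ sset G x u w) (hsz : Sw G g u z) :
    2 * (k - 2) + 1 ≤ k + ((sset G x u w).filter (fun y => Sw G g u y)).card := by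
  have c1 := card_sset (all_k X hg x).1 C.pair.au C.pair.aw C.pair.ne
  have c2 := card_sset (all_k X hg u).1 Cu.pair.au Cu.pair.aw Cu.pair.ne
  have hinter : (sset G x u w) ∩ (sset G u x b) ⊆
      (sset G x u w).filter (fun y => Sw G g u y) := by
    intro y hy
    rw [mem_inter, mem_sset, mem_sset] at hy
    rw [mem_filter, mem_sset]
    exact ⟨hy.1, Cu.sw y hy.2.2.2 hy.2.2.1 hy.2.1⟩
  have h3 := card_union_add_card_inter (sset G x u w) (sset G u x b)
  have h4 := card_le_card hinter
  have hsub : insert x (insert u (((sset G x u w) ∪ (sset G u x b)).erase z)) ⊆ nb G z := by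
    rw [mem_sset] at hz
    have hs := C.sw z hz.2.2 hz.2.1 hz.1
    intro y hy
    rw [mem_insert, mem_insert, mem_erase, mem_union, mem_sset, mem_sset] at hy
    rw [mem_nb]
    rcases hy with rfl | rfl | ⟨hyz, h | h⟩
    · exact hz.2.2.symm
    · exact hsz.1.symm
    · exact adj_of_sw X hg hs (C.sw y h.2.2 h.2.1 h.1).solo hyz
    · exact adj_of_sw X hg hsz (Cu.sw y h.2.2 h.2.1 h.1).solo hyz
  have h5 := card_le_card hsub
  rw [(all_k X hg z).1, card_insert_of_notMem, card_insert_of_notMem, card_erase_of_mem] at h5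
  · omega
  · rw [mem_union]; exact Or.inl hz
  · simp [mem_sset]
  · simp [mem_sset, C.pair.au.ne]

open Classical in
theorem exists_B (X : Ctx G k s) (hg : Eqb G s g) (hk : 3 ≤ k) (hodd : Odd k) (x : V) :
    ∃ x u w t, IsB G g x u w t := by
  by_contra hcon
  push Not at hcon
  have hC : ∀ v, ∃ a b, IsC G g v a b := by
    intro v
    rcases str X hg v with h | ⟨u, w, t, h⟩
    · exact h
    · exact (hcon _ _ _ _ h).elim
  obtain ⟨u, w, C⟩ := hC x
  have hCu : ∃ b, IsC G g u x b := by
    obtain ⟨a, b, Cu⟩ := hC u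
    rcases Cu.mem_of_dbl (dbl_of_two C.pair.au C.pair.aw C.pair.col C.pair.ne) with rfl | rfl
    · exact ⟨_, Cu⟩
    · exact ⟨_, Cu.swap⟩
  have hCw : ∃ b, IsC G g w x b := by
    obtain ⟨a, b, Cu⟩ := hC w
    rcases Cu.mem_of_dbl (dbl_of_two C.pair.aw C.pair.au C.pair.col.symm C.pair.ne.symm) with
      rfl | rfl
    · exact ⟨_, Cu⟩
    · exact ⟨_, Cu.swap⟩
  obtain ⟨bu, Cu⟩ := hCu
  obtain ⟨bw, Cw⟩ := hCw
  have hcov : ∀ z ∈ sset G x u w, Sw G g u z ∨ Sw G g w z := by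
    intro z hz
    rw [mem_sset] at hz
    exact C.cover X hg Cu Cw hz.2.2 hz.2.1 hz.1
  have c1 := card_sset (all_k X hg x).1 C.pair.au C.pair.aw C.pair.ne
  have hsymm : sset G x w u = sset G x u w := by ext y; simp only [mem_sset]; tauto
  -- not all on one side
  have one : ∀ u w, IsC G g x u w → ¬ ∀ z ∈ sset G x u w, Sw G g u z := by
    intro u w C hall
    have hxn : x ∉ insert u (sset G x u w) := by simp [mem_sset, C.pair.au.ne]
    have hun : u ∉ sset G x u w := by simp [mem_sset]
    have c1 := card_sset (all_k X hg x).1 C.pair.au C.pair.aw C.pair.ne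
    apply X.cliq (insert x (insert u (sset G x u w)))
    · rw [card_insert_of_notMem hxn, card_insert_of_notMem hun, c1]; omega
    have hS : ∀ a ∈ sset G x u w, Sw G g x a := by
      intro a ha; rw [mem_sset] at ha; exact C.sw a ha.2.2 ha.2.1 ha.1
    intro a ha b hb hab
    rw [mem_insert, mem_insert] at ha hb
    rcases ha with rfl | rfl | ha
    · rcases hb with rfl | rfl | hb
      · exact absurd rfl hab
      · exact C.pair.au
      · exact (hS b hb).1
    · rcases hb with rfl | rfl | hb
      · exact C.pair.au.symm
      · exact absurd rfl hab
      · exact (hall b hb).1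
    · rcases hb with rfl | rfl | hb
      · exact (hS a ha).1.symm
      · exact (hall a ha).1.symm
      · exact adj_of_sw X hg (hS a ha) (hS b hb).solo hab.symm
  have o1 := one u w C
  have o2 := one w u C.swap
  push Not at o1 o2
  obtain ⟨z2, hz2, hn2⟩ := o1
  obtain ⟨z1, hz1, hn1⟩ := o2
  have hz1' : z1 ∈ sset G x u w := by rw [← hsymm]; exact hz1
  have hz2' : z2 ∈ sset G x w u := by rw [hsymm]; exact hz2
  have s1 := (hcov z1 hz1').resolve_right hn1
  have s2 := (hcov z2 hz2).resolve_left hn2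
  have q1 := C.half X hg Cu hz1' s1
  have q2 := C.swap.half X hg Cw hz2' s2
  rw [hsymm] at q2
  have hdis : Disjoint ((sset G x u w).filter (fun y => Sw G g u y))
      ((sset G x u w).filter (fun y => Sw G g w y)) := by
    rw [disjoint_filter]
    intro y _ h1 h2
    exact C.pair.ne (h1.2.2 w h2.1.symm C.pair.col.symm).symm
  have hun : ((sset G x u w).filter (fun y => Sw G g u y)) ∪
      ((sset G x u w).filter (fun y => Sw G g w y)) ⊆ sset G x u w :=
    union_subset (filter_subset _ _) (filter_subset _ _)
  have q3 := card_le_card hun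
  rw [card_union_of_disjoint hdis, c1] at q3
  have p1 : 0 < ((sset G x u w).filter (fun y => Sw G g u y)).card :=
    card_pos.2 ⟨z1, mem_filter.2 ⟨hz1', s1⟩⟩
  have p2 : 0 < ((sset G x u w).filter (fun y => Sw G g w y)).card :=
    card_pos.2 ⟨z2, mem_filter.2 ⟨hz2, s2⟩⟩
  obtain ⟨m, hm⟩ := hodd
  omega

end noB
end EqCol
namespace EqCol

open Finset

section three

variable {V : Type} [Fintype V] [DecidableEq V]
variable {G : SimpleGraph V} {s : ℕ} {g : V → Fin 3}

lemma fin3 {p q r c : Fin 3} (h1 : p ≠ q) (h2 : p ≠ r) (h3 : q ≠ r) (h4 : c ≠ p) (h5 : c ≠ q) :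
    c = r := by
  omega

lemma no_tri (X : Ctx G 3 s) {a b c : V} (h1 : G.Adj a b) (h2 : G.Adj b c) (h3 : G.Adj a c) :
    False := by
  apply X.cliq {a, b, c} (card_eq_three.2 ⟨a, b, c, h1.ne, h3.ne, h2.ne, rfl⟩)
  intro x hx y hy hxy
  simp only [mem_insert, mem_singleton] at hx hy
  rcases hx with rfl | rfl | rfl <;> rcases hy with rfl | rfl | rfl <;>
    first | exact absurd rfl hxy | assumption | (apply SimpleGraph.Adj.symm; assumption)

lemma IsB.col3 {k : ℕ} {g : V → Fin k} {x a w b : V} (B : IsB G g x a w b) : g a ≠ g b := by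
  intro h
  exact B.tu (B.pair.uniq B.dt.1 B.tu B.tw a B.pair.au h).symm

lemma IsB.adj3 (X : Ctx G 3 s) {x a w b : V} (B : IsB G g x a w b) {y : V}
    (hy : G.Adj x y) : y = a ∨ y = w ∨ y = b := by
  have hsub : ({a, w, b} : Finset V) ⊆ nb G x := by
    intro z; simp only [mem_insert, mem_singleton, mem_nb]
    rintro (rfl | rfl | rfl)
    · exact B.pair.au
    · exact B.pair.aw
    · exact B.dt.1
  have hc : ({a, w, b} : Finset V).card = 3 :=
    card_eq_three.2 ⟨a, w, b, B.pair.ne, B.tu.symm, B.tw.symm, rfl⟩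
  have := eq_of_subset_of_card_le hsub (by rw [hc]; exact X.deg x)
  have h := mem_nb.2 hy
  rw [← this] at h
  simpa using h

lemma three_step1 (X : Ctx G 3 s) (hg : Eqb G s g) {x a w b : V} (B : IsB G g x a w b) :
    ∃ a2 b2, IsB G g w a2 x b2 := by
  have hwx : Dbl G g w x := dbl_of_two B.pair.aw B.pair.au B.pair.col.symm B.pair.ne.symm
  obtain ⟨_, x', hx', hxx', hcx'⟩ := B.dw
  rcases str X hg w with ⟨p, q, C⟩ | ⟨p, q, t, C⟩
  · exfalso
    have hpc : g p = g x := by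
      rcases C.mem_of_dbl hwx with h | h
      · rw [← h]
      · rw [h]; exact C.pair.col
    have hxa := hg.1 _ _ B.pair.au
    have hxb := hg.1 _ _ B.dt.1
    have hab := B.col3
    have hgw : g w = g a := B.pair.col.symm
    obtain ⟨y, hy, hcy⟩ := C.partner X hg (g b) (by rw [hgw]; exact hab.symm)
      (by rw [hpc]; exact hxb.symm)
    have hg' := swap_eqb hg hy
    obtain ⟨a', w', A⟩ := B.prev X hg
    have hyx : ¬ G.Adj x y := fun h => no_tri X B.pair.aw hy.1 h
    have haw : a ≠ w := B.pair.ne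
    have hay : a ≠ y := by rintro rfl; exact hab hcy
    have hxw : x ≠ w := B.pair.aw.ne
    have hxy : x ≠ y := by rintro rfl; exact hxb hcy
    have hga' : g a' = g b := by
      refine fin3 hxa hxb hab A.col3 (hg.1 _ _ A.pair.au).symm
    have ha'y : a' ≠ y := by
      rintro rfl
      exact haw (A.su.2 w hy.1.symm hgw).symm
    have ha'w : a' ≠ w := by
      rintro rfl; exact hab (hgw ▸ hga')
    have ea : (g ∘ Equiv.swap w y) a = g a := by
      simp [Equiv.swap_apply_of_ne_of_ne haw hay]
    have ex : (g ∘ Equiv.swap w y) x = g x := by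
      simp [Equiv.swap_apply_of_ne_of_ne hxw hxy]
    have hsw : Sw G (g ∘ Equiv.swap w y) a x := by
      refine ⟨B.pair.au.symm, ?_, ?_⟩
      · intro z hz hc
        rw [ex] at hc
        by_cases h1 : z = w
        · subst h1; exact (hg.1 _ _ hz hgw.symm).elim
        by_cases h2 : z = y
        · subst h2
          simp only [Function.comp, Equiv.swap_apply_right] at hc
          rw [hgw] at hc
          exact (hxa hc.symm).elim
        simp only [Function.comp, Equiv.swap_apply_of_ne_of_ne h1 h2] at hc
        exact B.su.2 z hz hc
      · intro z hz hc
        rw [ea] at hc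
        by_cases h1 : z = w
        · subst h1
          simp only [Function.comp, Equiv.swap_apply_left] at hc
          exact (hab (hc.symm.trans hcy)).elim
        by_cases h2 : z = y
        · subst h2; exact (hyx hz).elim
        simp only [Function.comp, Equiv.swap_apply_of_ne_of_ne h1 h2] at hc
        by_contra hza
        exact h1 (B.pair.swap.uniq hz h1 hza w B.pair.aw (hgw.trans hc.symm)).symm
    have hso : Solo G (g ∘ Equiv.swap w y) a a' := by
      refine ⟨A.pair.au, ?_⟩
      intro z hz hc
      rw [ea] at hc
      by_cases h1 : z = w
      · subst h1
        simp only [Function.comp, Equiv.swap_apply_left] at hc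
        exact (hab (hc.symm.trans hcy)).elim
      by_cases h2 : z = y
      · subst h2
        exact (hg.1 _ _ hz (hga'.trans hcy.symm)).elim
      simp only [Function.comp, Equiv.swap_apply_of_ne_of_ne h1 h2] at hc
      exact A.su.2 z hz hc
    have hadj := adj_of_sw X hg' hsw hso (by rintro rfl; exact hxb hga')
    exact no_tri X B.pair.au A.pair.au hadj
  · have : q = x := by
      rcases C.pair.only x x' B.pair.aw.symm hx' hcx'.symm hxx'.symm with h | h
      · have := C.su
        rw [← h.1] at this
        exact (not_solo_dbl this hwx).elim
      · exact h.1.symm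
    subst this
    exact ⟨p, t, C⟩

lemma three_step2 (X : Ctx G 3 s) (hg : Eqb G s g) {x a w b w1 c w2 d : V}
    (B : IsB G g x a w b) (B1 : IsB G g b x w1 c) (B2 : IsB G g c b w2 d) :
    ∃ b3, IsB G g w2 w c b3 := by
  obtain ⟨a3, b3, B3⟩ := three_step1 X hg B2
  have hxa := hg.1 _ _ B.pair.au
  have hxb := hg.1 _ _ B.dt.1
  have hab := B.col3
  have hcc : g c = g a :=
    fin3 hxb hxa hab.symm B1.col3.symm (hg.1 _ _ B1.dt.1).symm
  have hw2 : g w2 = g b := B2.pair.col.symm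
  have ha3 : g a3 = g a := B3.pair.col.trans hcc
  have hbc : G.Adj b c := B1.dt.1
  have hcw : G.Adj c w2 := B2.pair.aw
  have hwa : G.Adj w2 a3 := B3.pair.au
  have hbw2 : b ≠ w2 := B2.pair.ne
  have hca3 : c ≠ a3 := B3.pair.ne.symm
  have hba3 : b ≠ a3 := by rintro rfl; exact hab ha3.symm
  have hne_bc : b ≠ c := hbc.ne
  have hne_cw : c ≠ w2 := hcw.ne
  have hne_wa : w2 ≠ a3 := hwa.ne
  set g' : V → Fin 3 := (g ∘ Equiv.swap b c) ∘ Equiv.swap w2 a3 with hg'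
  have eb : g' b = g a := by
    simp only [hg', Function.comp]
    rw [Equiv.swap_apply_of_ne_of_ne hbw2 hba3, Equiv.swap_apply_left, hcc]
  have ec : g' c = g b := by
    simp only [hg', Function.comp]
    rw [Equiv.swap_apply_of_ne_of_ne hne_cw hca3, Equiv.swap_apply_right]
  have ew : g' w2 = g a := by
    simp only [hg', Function.comp]
    rw [Equiv.swap_apply_left, Equiv.swap_apply_of_ne_of_ne hba3.symm hca3.symm, ha3]
  have ea : g' a3 = g b := by
    simp only [hg', Function.comp]
    rw [Equiv.swap_apply_right, Equiv.swap_apply_of_ne_of_ne hbw2.symm hne_cw.symm, hw2]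
  have eo : ∀ y, y ≠ b → y ≠ c → y ≠ w2 → y ≠ a3 → g' y = g y := by
    intro y h1 h2 h3 h4
    simp only [hg', Function.comp]
    rw [Equiv.swap_apply_of_ne_of_ne h3 h4, Equiv.swap_apply_of_ne_of_ne h1 h2]
  -- the four path is closed
  have cb : ∀ y, G.Adj b y → g y = g a → y = c := by
    intro y hy hc
    have h1 : y ≠ x := by rintro rfl; exact hxa hc
    have h2 : y ≠ w1 := by rintro rfl; exact hxa (B1.pair.col.trans hc)
    by_contra h3
    exact h3 (B1.pair.uniq hy h1 h2 c hbc (hcc.trans hc.symm)).symm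
  have cc : ∀ y, G.Adj c y → g y = g b → y = b ∨ y = w2 := by
    intro y hy hc
    by_contra h
    push Not at h
    exact h.1 (B2.pair.uniq hy h.1 h.2 b hbc.symm hc.symm).symm
  have cw : ∀ y, G.Adj w2 y → g y = g a → y = a3 ∨ y = c := by
    intro y hy hc
    by_contra h
    push Not at h
    exact h.1 (B3.pair.uniq hy h.1 h.2 a3 hwa (ha3.trans hc.symm)).symm
  have ca : ∀ y, G.Adj a3 y → g y = g b → y = w2 := by
    intro y hy hc
    exact B3.su.2 y hy (hc.trans hw2.symm)
  have key : ∀ p q, G.Adj p q → (p = b ∨ p = c ∨ p = w2 ∨ p = a3) → g' p ≠ g' q := by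
    intro p q hpq hp
    by_cases hq : q = b ∨ q = c ∨ q = w2 ∨ q = a3
    · rcases hp with rfl | rfl | rfl | rfl <;> rcases hq with rfl | rfl | rfl | rfl <;>
        first
        | exact absurd rfl hpq.ne
        | (simp only [eb, ec, ew, ea]; first | exact hab | exact hab.symm)
        | (exfalso; refine hg.1 _ _ hpq ?_; simp only [hcc, hw2, ha3])
    · push Not at hq
      rw [eo q hq.1 hq.2.1 hq.2.2.1 hq.2.2.2]
      rcases hp with rfl | rfl | rfl | rfl
      · rw [eb]; intro h; exact hq.2.1 (cb q hpq h.symm)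
      · rw [ec]; intro h; rcases cc q hpq h.symm with h | h
        · exact hq.1 h
        · exact hq.2.2.1 h
      · rw [ew]; intro h; rcases cw q hpq h.symm with h | h
        · exact hq.2.2.2 h
        · exact hq.2.1 h
      · rw [ea]; intro h; exact hq.2.2.1 (ca q hpq h.symm)
  have hE : Eqb G s g' := by
    refine ⟨?_, fun c => by rw [hg', cls_perm, cls_perm]; exact hg.2 c⟩
    intro p q hpq
    by_cases hp : p = b ∨ p = c ∨ p = w2 ∨ p = a3
    · exact key p q hpq hp
    by_cases hq : q = b ∨ q = c ∨ q = w2 ∨ q = a3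
    · exact (key q p hpq.symm hq).symm
    push Not at hp hq
    rw [eo q hq.1 hq.2.1 hq.2.2.1 hq.2.2.2, eo p hp.1 hp.2.1 hp.2.2.1 hp.2.2.2]
    exact hg.1 p q hpq
  have hx : g' x = g x := by
    apply eo
    · exact B.dt.1.ne
    · rintro rfl; exact hxa hcc
    · rintro rfl; exact hxb hw2
    · rintro rfl; exact hxa ha3
  have hxc : ¬ G.Adj x c := fun h => no_tri X B.dt.1 hbc h
  obtain ⟨y, hy, hc⟩ := rigid X hE x (g b) (by rw [hx]; exact hxb.symm)
  have hyb : y ≠ b := by rintro rfl; rw [eb] at hc; exact hab hc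
  have hyc : y ≠ c := by rintro rfl; exact hxc hy
  have hyw : y ≠ w2 := by rintro rfl; rw [ew] at hc; exact hab hc
  have hgy : g y = g a := by
    rcases B.adj3 X hy with rfl | rfl | rfl
    · rfl
    · exact B.pair.col.symm
    · exact absurd rfl hyb
  have hya : y = a3 := by
    by_contra h
    rw [eo y hyb hyc hyw h, hgy] at hc
    exact hab hc
  rcases B.adj3 X hy with h | h | h
  · exfalso
    obtain ⟨a', w', A⟩ := B.prev X hg
    have hga' : g a' = g b :=
      fin3 hxa hxb hab A.col3 (hg.1 _ _ A.pair.au).symm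
    rw [← h, hya] at A
    have h1 := ca a' A.pair.au hga'
    have h2 := ca w' A.pair.aw (A.pair.col.symm.trans hga')
    exact A.pair.ne (h1.trans h2.symm)
  · rw [← h, hya]; exact ⟨b3, B3⟩
  · exact absurd h hyb

theorem three_main (X : Ctx G 3 s) (hg : Eqb G s g) {x0 a w0 x1 : V}
    (B0 : IsB G g x0 a w0 x1) : False := by
  obtain ⟨w1, x2, B1⟩ := B0.next X hg
  obtain ⟨w2, x3, B2⟩ := B1.next X hg
  obtain ⟨w3, x4, B3⟩ := B2.next X hg
  obtain ⟨w4, x5, B4⟩ := B3.next X hg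
  obtain ⟨c0, D2⟩ := three_step2 X hg B0 B1 B2
  obtain ⟨c1, D4⟩ := three_step2 X hg B2 B3 B4
  obtain ⟨e, f, D0⟩ := D2.prev X hg
  obtain ⟨e', f', D0'⟩ := three_step1 X hg B0
  obtain ⟨e2, f2, D2'⟩ := D4.prev X hg
  have h1 := (D0'.uniq D0).2.1
  have h2 := (D2'.uniq D2).2.2
  subst h1
  subst h2
  obtain ⟨b, E⟩ := three_step2 X hg D0 D2 D4
  have h3 := (B4.uniq E).1
  subst h3
  exact no_tri X B0.dt.1 B1.dt.1 B2.dt.1.symm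

end three
end EqCol
namespace EqCol

open Finset

section big

variable {V : Type} [Fintype V] [DecidableEq V] {k : ℕ}
variable {G : SimpleGraph V} {s : ℕ} {g : V → Fin k}

lemma dbl_col (X : Ctx G k s) (hg : Eqb G s g) {x p q : V} (hp : Dbl G g p x)
    (hq : Dbl G g q x) : g p = g q := by
  obtain ⟨u, w, P⟩ := exists_pair X hg x (all_k X hg x).1
  have key : ∀ p, Dbl G g p x → g p = g u := by
    rintro p ⟨h1, y, h2, h3, h4⟩
    rcases P.only p y h1.symm h2 h4.symm h3.symm with h | h
    · rw [h.1]
    · rw [h.1, P.col]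
  rw [key p hp, key q hq]

lemma IsB.ne_col {x a w b z : V} (B : IsB G g x a w b) (hz : G.Adj x z) (h1 : z ≠ a)
    (h2 : z ≠ w) : g z ≠ g a := fun h => h1 (B.pair.uniq hz h1 h2 a B.pair.au h.symm).symm

lemma IsB.ne_col' {x a w b z : V} (B : IsB G g x a w b) (hz : G.Adj x z) (h : z ≠ b) :
    g z ≠ g b := fun hc => h (B.pair.uniq B.dt.1 B.tu B.tw z hz hc)

lemma r1 (X : Ctx G k s) (hg : Eqb G s g) {x a w b w1 c z : V} (B : IsB G g x a w b)
    (B1 : IsB G g b x w1 c) (hz : G.Adj x z) (h1 : z ≠ a) (h2 : z ≠ w) (h3 : z ≠ b)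
    (hc : g z ≠ g c) : Sw G g b z := by
  have hzb := B.ne_col' hz h3
  have hzx : g z ≠ g x := (hg.1 _ _ hz).symm
  obtain ⟨y, hy, hcy⟩ := rigid X hg b (g z) hzb
  have hsw : Sw G g b y := by
    apply B1.sw y hy
    · rintro rfl; exact hzx hcy.symm
    · rintro rfl; exact hzx (hcy.symm.trans B1.pair.col.symm)
    · rintro rfl; exact hc hcy.symm
  by_cases hyz : y = z
  · rw [← hyz]; exact hsw
  exfalso
  have hxb : x ≠ b := B.dt.1.ne
  have hxy : x ≠ y := by rintro rfl; exact hzx hcy.symm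
  have hnxy : ¬ G.Adj x y := fun h => hyz (B.pair.uniq hz h1 h2 y h hcy)
  obtain ⟨q, hq, hcq⟩ := rigid X (swap_eqb hg hsw) x (g b) (by
    simp only [Function.comp]
    rw [Equiv.swap_apply_of_ne_of_ne hxb hxy]
    exact (hg.1 _ _ B.dt.1).symm)
  simp only [Function.comp] at hcq
  by_cases e1 : q = b
  · subst e1
    rw [Equiv.swap_apply_left, hcy] at hcq
    exact hzb hcq
  by_cases e2 : q = y
  · subst e2; exact hnxy hq
  rw [Equiv.swap_apply_of_ne_of_ne e1 e2] at hcq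
  exact B.ne_col' hq e1 hcq

/-- the switchable neighbours -/
noncomputable def tset (G : SimpleGraph V) (x a w b : V) : Finset V :=
  (((nb G x).erase a).erase w).erase b

lemma mem_tset {x a w b y : V} : y ∈ tset G x a w b ↔ G.Adj x y ∧ y ≠ a ∧ y ≠ w ∧ y ≠ b := by
  simp only [tset, mem_erase, mem_nb]; tauto

lemma IsB.card_tset (X : Ctx G k s) (hg : Eqb G s g) {x a w b : V} (B : IsB G g x a w b) :
    (tset G x a w b).card = k - 3 := by
  unfold tset
  rw [card_erase_of_mem, card_erase_of_mem, card_erase_of_mem (mem_nb.2 B.pair.au),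
    (all_k X hg x).1]
  · omega
  · rw [mem_erase, mem_nb]; exact ⟨B.pair.ne.symm, B.pair.aw⟩
  · rw [mem_erase, mem_erase, mem_nb]; exact ⟨B.tw, B.tu, B.dt.1⟩

lemma IsB.tsw {x a w b z : V} (B : IsB G g x a w b) (hz : z ∈ tset G x a w b) : Sw G g x z := by
  rw [mem_tset] at hz
  exact B.sw z hz.1 hz.2.1 hz.2.2.1 hz.2.2.2

lemma IsB.t_adj (X : Ctx G k s) (hg : Eqb G s g) {x a w b z : V} (B : IsB G g x a w b)
    (hz : z ∈ tset G x a w b) : G.Adj z a :=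
  adj_of_sw X hg (B.tsw hz) B.su (mem_tset.1 hz).2.1.symm

/-- forbidden clique -/
lemma IsB.no_clique (X : Ctx G k s) (hg : Eqb G s g) {x a w b : V} (B : IsB G g x a w b)
    (hk : 3 ≤ k) (hab : G.Adj a b) (h : ∀ z ∈ tset G x a w b, G.Adj b z) : False := by
  have n1 : b ∉ tset G x a w b := by simp [mem_tset]
  have n2 : x ∉ insert b (tset G x a w b) := by simp [mem_tset, B.dt.1.ne]
  have n3 : a ∉ insert x (insert b (tset G x a w b)) := by
    simp [mem_tset, B.tu.symm, B.pair.au.ne.symm]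
  apply X.cliq (insert a (insert x (insert b (tset G x a w b))))
  · rw [card_insert_of_notMem n3, card_insert_of_notMem n2, card_insert_of_notMem n1,
      B.card_tset X hg]; omega
  have hx := B.pair.au
  have hb := B.dt.1
  have hS : ∀ z ∈ tset G x a w b, G.Adj x z := fun z hz => (B.tsw hz).1
  have ha : ∀ z ∈ tset G x a w b, G.Adj z a := fun z hz => B.t_adj X hg hz
  intro p hp q hq hpq
  rw [mem_insert, mem_insert, mem_insert] at hp hq
  rcases hp with rfl | rfl | rfl | hp
  · rcases hq with rfl | rfl | rfl | hq
    · exact absurd rfl hpq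
    · exact hx.symm
    · exact hab
    · exact (ha q hq).symm
  · rcases hq with rfl | rfl | rfl | hq
    · exact hx
    · exact absurd rfl hpq
    · exact hb
    · exact hS q hq
  · rcases hq with rfl | rfl | rfl | hq
    · exact hab.symm
    · exact hb.symm
    · exact absurd rfl hpq
    · exact h q hq
  · rcases hq with rfl | rfl | rfl | hq
    · exact ha p hp
    · exact (hS p hp).symm
    · exact (h p hp).symm
    · exact adj_of_sw X hg (B.tsw hp) (B.tsw hq).solo hpq.symm

lemma case_a (X : Ctx G k s) (hg : Eqb G s g) (hk : 5 ≤ k) {x a w b w1 c : V}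
    (B : IsB G g x a w b) (B1 : IsB G g b x w1 c) : g a ≠ g c := by
  intro hac
  obtain ⟨w2, d, B2⟩ := B1.next X hg
  have hall : ∀ z ∈ tset G x a w b, Sw G g b z := by
    intro z hz
    rw [mem_tset] at hz
    refine r1 X hg B B1 hz.1 hz.2.1 hz.2.2.1 hz.2.2.2 ?_
    rw [← hac]; exact B.ne_col hz.1 hz.2.1 hz.2.2.1
  have hcard := B.card_tset X hg
  have hex : ∃ z ∈ tset G x a w b, g z ≠ g d := by
    obtain ⟨z1, h1, z2, h2, hne⟩ := one_lt_card.1 (show 1 < (tset G x a w b).card by omega)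
    by_cases h : g z1 = g d
    · refine ⟨z2, h2, fun h' => hne ?_⟩
      exact (B.tsw h2).2.1 z1 (mem_tset.1 h1).1 (h.trans h'.symm)
    · exact ⟨z1, h1, h⟩
  obtain ⟨z, hz, hzd⟩ := hex
  have hz' := mem_tset.1 hz
  have hzx : g z ≠ g x := (hg.1 _ _ hz'.1).symm
  have hza := B.ne_col hz'.1 hz'.2.1 hz'.2.2.1
  have hcz : Sw G g c z := by
    refine r1 X hg B1 B2 (hall z hz).1 ?_ ?_ ?_ hzd
    · rintro rfl; exact hzx rfl
    · rintro rfl; exact hzx B1.pair.col.symm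
    · rintro rfl; exact hza hac.symm
  have hca : a = c := hcz.2.2 a (B.t_adj X hg hz) hac
  refine B.no_clique X hg (by omega) ?_ (fun z hz => (hall z hz).1)
  rw [hca]; exact B1.dt.1.symm

lemma case_b1 (X : Ctx G k s) (hg : Eqb G s g) (hk : 5 ≤ k) {x a w b w1 c : V}
    (B : IsB G g x a w b) (B1 : IsB G g b x w1 c) : ¬ G.Adj a b := by
  intro hab
  have hac := case_a X hg hk B B1
  have hxc : g x ≠ g c := B1.col3
  have hbc := hg.1 _ _ B1.dt.1
  have hba : Sw G g b a := by
    have hax := hg.1 _ _ B.pair.au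
    apply B1.sw a hab.symm
    · rintro rfl; exact hax rfl
    · rintro rfl; exact hax B1.pair.col
    · rintro rfl; exact hac rfl
  obtain ⟨t, ht, hct⟩ := rigid X hg x (g c) hxc.symm
  have hta : t ≠ a := by rintro rfl; exact hac hct
  have htw : t ≠ w := by rintro rfl; exact hac (B.pair.col.trans hct)
  have htb : t ≠ b := by rintro rfl; exact hbc hct
  have htS : t ∈ tset G x a w b := mem_tset.2 ⟨ht, hta, htw, htb⟩
  have hsw : ∀ z ∈ tset G x a w b, z ≠ t → Sw G g b z := by
    intro z hz hzt
    have hz' := mem_tset.1 hz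
    refine r1 X hg B B1 hz'.1 hz'.2.1 hz'.2.2.1 hz'.2.2.2 ?_
    intro h
    exact hzt ((B.tsw htS).2.1 z hz'.1 (h.trans hct.symm))
  have hnb : ¬ G.Adj b t := by
    intro h
    refine B.no_clique X hg (by omega) hab ?_
    intro z hz
    by_cases hzt : z = t
    · rw [hzt]; exact h
    · exact (hsw z hz hzt).1
  have hcard := B.card_tset X hg
  obtain ⟨z, hz, hzt⟩ := exists_mem_ne (show 1 < (tset G x a w b).card by omega) t
  have hz' := mem_tset.1 hz
  have hbz := hsw z hz hzt
  have hzt' : G.Adj z t := adj_of_sw X hg (B.tsw hz) (B.tsw htS).solo hzt.symm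
  have d1 : Dbl G g z t := by
    by_contra h
    rw [not_dbl hzt'] at h
    exact hnb (adj_of_sw X hg hbz.symm h htb)
  have d2 : Dbl G g a t := by
    by_contra h
    rw [not_dbl (B.t_adj X hg htS).symm] at h
    exact hnb (adj_of_sw X hg hba.symm h htb)
  exact B.ne_col hz'.1 hz'.2.1 hz'.2.2.1 (dbl_col X hg d1 d2)

lemma case_b2 (X : Ctx G k s) (hg : Eqb G s g) (hk : 5 ≤ k) {x a w b w1 c z : V}
    (B : IsB G g x a w b) (B1 : IsB G g b x w1 c) (hz : z ∈ tset G x a w b) (hc : g z ≠ g c) :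
    Dbl G g z a := by
  have hz' := mem_tset.1 hz
  have hbz := r1 X hg B B1 hz'.1 hz'.2.1 hz'.2.2.1 hz'.2.2.2 hc
  by_contra h
  rw [not_dbl (B.t_adj X hg hz)] at h
  exact case_b1 X hg hk B B1 (adj_of_sw X hg hbz.symm h B.tu.symm).symm

lemma k_eq_five (X : Ctx G k s) (hg : Eqb G s g) (hk : 5 ≤ k) (hodd : Odd k) {x a w b : V}
    (B : IsB G g x a w b) : k = 5 := by
  obtain ⟨w1, c, B1⟩ := B.next X hg
  obtain ⟨t, ht, hct⟩ := rigid X hg x (g c) B1.col3.symm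
  have hcard := B.card_tset X hg
  have h1 : ((tset G x a w b).erase t).card ≤ 1 := by
    rw [card_le_one]
    intro y hy z hz
    rw [mem_erase] at hy hz
    have hne : ∀ y, y ≠ t → y ∈ tset G x a w b → g y ≠ g c := by
      intro y h1 h2 h3
      exact h1 ((B.tsw h2).2.1 t ht (hct.trans h3.symm)).symm
    have d1 := case_b2 X hg hk B B1 hy.2 (hne y hy.1 hy.2)
    have d2 := case_b2 X hg hk B B1 hz.2 (hne z hz.1 hz.2)
    exact (B.tsw hz.2).2.1 y (mem_tset.1 hy.2).1 (dbl_col X hg d1 d2)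
  have h2 := pred_card_le_card_erase (s := tset G x a w b) (a := t)
  obtain ⟨m, hm⟩ := hodd
  omega

/-- five distinct consecutive colours -/
lemma case_b3 (X : Ctx G k s) (hg : Eqb G s g) (hk : 5 ≤ k) {p x a w b w0 w1 c : V}
    (A : IsB G g a p w0 x) (B : IsB G g x a w b) (B1 : IsB G g b x w1 c) : g p ≠ g c := by
  have hcard := B.card_tset X hg
  obtain ⟨t, ht, hct⟩ := rigid X hg x (g c) B1.col3.symm
  obtain ⟨z, hz, hzt⟩ := exists_mem_ne (show 1 < (tset G x a w b).card by omega) t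
  have hzc : g z ≠ g c := fun h3 => hzt ((B.tsw hz).2.1 t ht (hct.trans h3.symm)).symm
  have d1 := case_b2 X hg hk B B1 hz hzc
  have d2 : Dbl G g p a := dbl_of_two A.pair.au A.pair.aw A.pair.col A.pair.ne
  rw [← dbl_col X hg d1 d2]; exact hzc

lemma sw_w (X : Ctx G k s) (hg : Eqb G s g) (hk : 5 ≤ k) {x a w b w1 c : V}
    (B : IsB G g x a w b) (B1 : IsB G g b x w1 c) : Sw G g b w := by
  have hac := case_a X hg hk B B1
  have hax := hg.1 _ _ B.pair.au
  obtain ⟨y, hy, hcy⟩ := rigid X hg b (g a) B.col3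
  have hsw : Sw G g b y := by
    apply B1.sw y hy
    · rintro rfl; exact hax hcy
    · rintro rfl; exact hax (B1.pair.col.trans hcy)
    · rintro rfl; exact hac hcy.symm
  have hxy : G.Adj y x := adj_of_sw X hg hsw B1.su (by rintro rfl; exact hax hcy)
  have hya : y ≠ a := by
    rintro rfl
    exact case_b1 X hg hk B B1 hy.symm
  have : y = w := by
    by_contra h
    exact B.ne_col hxy.symm hya h hcy
  rw [← this]; exact hsw

lemma exists_chain (X : Ctx G k s) (hg : Eqb G s g) {x a w b : V} (B : IsB G g x a w b) :
    ∃ x w : ℕ → V, ∀ n, IsB G g (x (n + 1)) (x n) (w (n + 1)) (x (n + 2)) := by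
  let S := {p : V × V × V × V // IsB G g p.1 p.2.1 p.2.2.1 p.2.2.2}
  have hstep : ∀ p : S, ∃ q : S, q.1.1 = p.1.2.2.2 ∧ q.1.2.1 = p.1.1 := by
    rintro ⟨⟨x, a, w, b⟩, B⟩
    obtain ⟨w', t', B'⟩ := IsB.next X hg B
    exact ⟨⟨(b, x, w', t'), B'⟩, rfl, rfl⟩
  choose f hf using hstep
  let q : ℕ → S := fun n => f^[n] ⟨(x, a, w, b), B⟩
  have hq : ∀ n, q (n + 1) = f (q n) := fun n => Function.iterate_succ_apply' f n _
  refine ⟨fun n => (q n).1.2.1, fun n => (q (n - 1)).1.2.2.1, ?_⟩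
  intro n
  have h1 : (q (n + 1)).1.2.1 = (q n).1.1 := by rw [hq]; exact (hf _).2
  have h2 : (q (n + 2)).1.2.1 = (q n).1.2.2.2 := by
    rw [hq (n + 1), (hf _).2, hq n, (hf _).1]
  simp only [h1, h2, Nat.add_sub_cancel]
  exact (q n).2

end big

/-- the ten vertex structure -/
structure Chain {V : Type} (G : SimpleGraph V) (g : V → Fin 5) (x w : ℕ → V) : Prop where
  nx : ∀ n y, G.Adj (x (n + 2)) y ↔
    y = x (n + 1) ∨ y = x (n + 3) ∨ y = w (n + 2) ∨ y = w (n + 1) ∨ y = w n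
  nw : ∀ n y, G.Adj (w (n + 1)) y ↔
    y = x (n + 1) ∨ y = x (n + 2) ∨ y = x (n + 3) ∨ y = w (n + 2) ∨ y = w n
  gw : ∀ n, g (w n) = g (x (n + 4))
  c1 : ∀ n, g (x n) ≠ g (x (n + 1))
  c2 : ∀ n, g (x n) ≠ g (x (n + 2))
  c3 : ∀ n, g (x n) ≠ g (x (n + 3))
  c4 : ∀ n, g (x n) ≠ g (x (n + 4))
  sw : ∀ n, Sw G g (x (n + 2)) (w n)
  xw : ∀ n, x n ≠ w (n + 1)

lemma fin5 {a b c d e f : Fin 5} (h1 : a ≠ b) (h2 : a ≠ c) (h3 : a ≠ d) (h4 : a ≠ e)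
    (h5 : b ≠ c) (h6 : b ≠ d) (h7 : b ≠ e) (h8 : c ≠ d) (h9 : c ≠ e) (h10 : d ≠ e)
    (k1 : f ≠ b) (k2 : f ≠ c) (k3 : f ≠ d) (k4 : f ≠ e) : f = a := by
  omega

lemma eq_five {V : Type} [Fintype V] [DecidableEq V] {G : SimpleGraph V} {s : ℕ}
    (X : Ctx G 5 s) {v : V} {a b c d e : V} (h1 : G.Adj v a) (h2 : G.Adj v b) (h3 : G.Adj v c)
    (h4 : G.Adj v d) (h5 : G.Adj v e) (hab : a ≠ b) (hac : a ≠ c) (had : a ≠ d) (hae : a ≠ e)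
    (hbc : b ≠ c) (hbd : b ≠ d) (hbe : b ≠ e) (hcd : c ≠ d) (hce : c ≠ e) (hde : d ≠ e) (y : V) :
    G.Adj v y ↔ y = a ∨ y = b ∨ y = c ∨ y = d ∨ y = e := by
  have hsub : ({a, b, c, d, e} : Finset V) ⊆ nb G v := by
    intro z; simp only [mem_insert, mem_singleton, mem_nb]
    rintro (rfl | rfl | rfl | rfl | rfl) <;> assumption
  have hc : ({a, b, c, d, e} : Finset V).card = 5 := by
    rw [card_insert_of_notMem, card_insert_of_notMem, card_insert_of_notMem,
      card_insert_of_notMem, card_singleton] <;> simp [*]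
  have := eq_of_subset_of_card_le hsub (by rw [hc]; exact X.deg v)
  rw [← mem_nb, ← this]
  simp

theorem get_chain {V : Type} [Fintype V] [DecidableEq V] {G : SimpleGraph V} {s : ℕ}
    {g : V → Fin 5} (X : Ctx G 5 s) (hg : Eqb G s g) {x a w b : V} (B : IsB G g x a w b) :
    ∃ x w : ℕ → V, Chain G g x w := by
  obtain ⟨x, w, hB⟩ := exists_chain X hg B
  have c1 : ∀ n, g (x n) ≠ g (x (n + 1)) := fun n => (hg.1 _ _ (hB n).pair.au).symm
  have c2 : ∀ n, g (x n) ≠ g (x (n + 2)) := fun n => (hB n).col3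
  have c3 : ∀ n, g (x n) ≠ g (x (n + 3)) := fun n => case_a X hg le_rfl (hB n) (hB (n + 1))
  have c4 : ∀ n, g (x n) ≠ g (x (n + 4)) := fun n =>
    case_b3 X hg le_rfl (hB n) (hB (n + 1)) (hB (n + 2))
  have c5 : ∀ n, g (x (n + 5)) = g (x n) := fun n =>
    fin5 (c1 n) (c2 n) (c3 n) (c4 n) (c1 (n + 1)) (c2 (n + 1)) (c3 (n + 1)) (c1 (n + 2))
      (c2 (n + 2)) (c1 (n + 3)) (c4 (n + 1)).symm (c3 (n + 2)).symm (c2 (n + 3)).symm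
      (c1 (n + 4)).symm
  have gw : ∀ n, g (w (n + 1)) = g (x n) := fun n => (hB n).pair.col.symm
  have sa : ∀ n, Sw G g (x (n + 2)) (w (n + 1)) := fun n =>
    sw_w X hg le_rfl (hB n) (hB (n + 1))
  have sb : ∀ n, Sw G g (x (n + 3)) (w (n + 1)) := by
    intro n
    refine r1 X hg (hB (n + 1)) (hB (n + 2)) (sa n).1 ?_ ?_ ?_ ?_
    · intro h; exact c1 n (by rw [← gw, h])
    · intro h; exact c1 n (by rw [← gw, h, gw])
    · intro h; exact c3 n (by rw [← gw, h])
    · rw [gw]; exact c4 n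
  have ww : ∀ n, G.Adj (w (n + 1)) (w (n + 2)) := by
    intro n
    refine adj_of_sw X hg (sb n) (sa (n + 1)).solo ?_
    intro h; exact c1 n (by rw [← gw, ← gw, h])
  have xw : ∀ n, x n ≠ w (n + 1) := fun n => (hB n).pair.ne
  have ne : ∀ {p q : V}, g p ≠ g q → p ≠ q := by rintro p q h rfl; exact h rfl
  refine ⟨fun n => x (n + 1), fun n => w (n + 1), ?_⟩
  constructor
  · intro n y
    apply eq_five X (hB (n + 2)).pair.au (hB (n + 2)).dt.1 (hB (n + 2)).pair.aw (sa (n + 1)).1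
      (sb n).1
    · exact ne (c2 _)
    · exact xw _
    · exact ne (by rw [gw]; exact (c1 _).symm)
    · exact ne (by rw [gw]; exact (c2 _).symm)
    · exact ne (by rw [gw]; exact (c2 _).symm)
    · exact ne (by rw [gw]; exact (c3 _).symm)
    · exact ne (by rw [gw]; exact (c4 _).symm)
    · exact ne (by rw [gw, gw]; exact (c1 _).symm)
    · exact ne (by rw [gw, gw]; exact (c2 _).symm)
    · exact ne (by rw [gw, gw]; exact (c1 _).symm)
  · intro n y
    apply eq_five X (hB (n + 1)).pair.aw.symm (sa (n + 1)).1.symm (sb (n + 1)).1.symm (ww (n + 1))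
      (ww n).symm
    · exact ne (c1 _)
    · exact ne (c2 _)
    · exact xw _
    · exact ne (by rw [gw]; exact (c2 _).symm)
    · exact ne (c1 _)
    · exact ne (by rw [gw]; exact (c1 _).symm)
    · exact ne (by rw [gw]; exact (c3 _).symm)
    · exact ne (by rw [gw]; exact (c2 _).symm)
    · exact ne (by rw [gw]; exact (c4 _).symm)
    · exact ne (by rw [gw, gw]; exact (c2 _).symm)
  · intro n
    change g (w (n + 1)) = g (x (n + 5))
    rw [gw, c5]
  · exact fun n => c1 _
  · exact fun n => c2 _
  · exact fun n => c3 _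
  · exact fun n => c4 _
  · exact fun n => sb n
  · exact fun n => xw _

end EqCol
namespace EqCol

open Finset

section ten

variable {V : Type} [Fintype V] [DecidableEq V]
variable {G : SimpleGraph V} {s : ℕ} {g : V → Fin 5} {x w : ℕ → V}

lemma Chain.c5 (C : Chain G g x w) (n : ℕ) : g (x (n + 5)) = g (x n) :=
  fin5 (C.c1 n) (C.c2 n) (C.c3 n) (C.c4 n) (C.c1 (n + 1)) (C.c2 (n + 1)) (C.c3 (n + 1))
    (C.c1 (n + 2)) (C.c2 (n + 2)) (C.c1 (n + 3)) (C.c4 (n + 1)).symm (C.c3 (n + 2)).symm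
    (C.c2 (n + 3)).symm (C.c1 (n + 4)).symm

lemma Chain.cmod (C : Chain G g x w) (n : ℕ) : g (x n) = g (x (n % 5)) := by
  induction n using Nat.strong_induction_on with
  | _ n ih =>
    by_cases h : n < 5
    · rw [Nat.mod_eq_of_lt h]
    · obtain ⟨m, rfl⟩ : ∃ m, n = m + 5 := ⟨n - 5, by omega⟩
      rw [C.c5, ih m (by omega)]
      congr 2
      omega

lemma Chain.col_iff (C : Chain G g x w) (i j : ℕ) :
    g (x i) = g (x j) ↔ i % 5 = j % 5 := by
  rw [C.cmod i, C.cmod j]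
  have hi : i % 5 < 5 := Nat.mod_lt _ (by norm_num)
  have hj : j % 5 < 5 := Nat.mod_lt _ (by norm_num)
  generalize i % 5 = a at *
  generalize j % 5 = b at *
  constructor
  · intro h
    have h01 := C.c1 0
    have h12 := C.c1 1
    have h23 := C.c1 2
    have h34 := C.c1 3
    have h02 := C.c2 0
    have h13 := C.c2 1
    have h24 := C.c2 2
    have h03 := C.c3 0
    have h14 := C.c3 1
    have h04 := C.c4 0
    norm_num at h01 h12 h23 h34 h02 h13 h24 h03 h14 h04
    interval_cases a <;> interval_cases b <;>
      first | rfl | (exfalso; first | contradiction | exact absurd h.symm (by assumption))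
  · rintro rfl; rfl

lemma Chain.x_ne_w (C : Chain G g x w) (m : ℕ) : x (m + 5) ≠ w (m + 1) := by
  intro h
  have key : ∀ y, G.Adj (x (m + 5)) y → g y = g (x (m + 4)) → y = w m := by
    intro y hy hc
    rw [h, C.nw] at hy
    rcases hy with rfl | rfl | rfl | rfl | rfl
    · rw [C.col_iff] at hc; omega
    · rw [C.col_iff] at hc; omega
    · rw [C.col_iff] at hc; omega
    · rw [C.gw, C.col_iff] at hc; omega
    · rfl
  have h1 := key (x (m + 4)) ((C.nx (m + 3) _).2 (Or.inl rfl)) rfl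
  have h2 := key (w (m + 5)) ((C.nx (m + 3) _).2 (Or.inr (Or.inr (Or.inl rfl))))
    (by rw [C.gw, C.col_iff]; omega)
  exact C.xw (m + 4) (h1.trans h2.symm)

lemma Chain.w_per (X : Ctx G 5 s) (hg : Eqb G s g) (C : Chain G g x w) (m : ℕ) :
    w (m + 6) = w (m + 1) := by
  by_contra H
  have H2 := C.x_ne_w m
  have hE := swap_eqb hg (C.sw (m + 1))
  set h := g ∘ Equiv.swap (x (m + 1 + 2)) (w (m + 1)) with hh
  have hv : h (w (m + 4)) = g (x (m + 3)) := by
    simp only [hh, Function.comp]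
    rw [Equiv.swap_apply_of_ne_of_ne (C.xw (m + 3)).symm, C.gw, C.col_iff]
    · omega
    · intro e
      have := congrArg g e
      rw [C.gw, C.gw, C.col_iff] at this
      omega
  have hd := (all_k X hE (w (m + 4))).2
  obtain ⟨b, hb⟩ : (dset G h (w (m + 4))).Nonempty := card_pos.1 (by omega)
  rw [mem_dset] at hb
  obtain ⟨hadj, y, hy, hyv, hc⟩ := hb
  rw [hv] at hc
  have hy' : y = w (m + 1) ∨ (y ≠ x (m + 3) ∧ g y = g (x (m + 3))) := by
    by_cases e1 : y = w (m + 1)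
    · exact Or.inl e1
    right
    simp only [hh, Function.comp] at hc
    by_cases e2 : y = x (m + 1 + 2)
    · rw [e2, Equiv.swap_apply_left, C.gw, C.col_iff] at hc
      omega
    · rw [Equiv.swap_apply_of_ne_of_ne e2 e1] at hc
      exact ⟨e2, hc⟩
  rw [show m + 4 = (m + 3) + 1 by ring, C.nw] at hadj
  have fin : ∀ y, y ≠ w (m + 4) →
      (y = w (m + 1) ∨ (y ≠ x (m + 3) ∧ g y = g (x (m + 3)))) →
      (y = x (m + 2) ∨ y = x (m + 3) ∨ y = x (m + 4) ∨ y = x (m + 5) ∨ y = x (m + 6) ∨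
        y = x (m + 7) ∨ y = w (m + 2) ∨ y = w (m + 3) ∨ y = w (m + 4) ∨ y = w (m + 5) ∨
        y = w (m + 6)) → False := by
    intro y h1 h2 h3
    rcases h2 with h2 | ⟨h2, h4⟩
    · rcases h3 with h3 | h3 | h3 | h3 | h3 | h3 | h3 | h3 | h3 | h3 | h3
      all_goals
        have h5 := congrArg g (h3.symm.trans h2)
        simp only [C.gw, C.col_iff] at h5
      any_goals omega
      · exact H2 (h3.symm.trans h2)
      · exact H (h3.symm.trans h2)
    · rcases h3 with h3 | h3 | h3 | h3 | h3 | h3 | h3 | h3 | h3 | h3 | h3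
      all_goals
        have h5 := h4
        rw [h3] at h5
        simp only [C.gw, C.col_iff] at h5
      any_goals omega
      · exact h2 h3
      · exact h1 h3
  refine fin y hyv hy' ?_
  rcases hadj with rfl | rfl | rfl | rfl | rfl
  · have := (C.nx (m + 2) y).1 hy; tauto
  · have := (C.nx (m + 3) y).1 hy; tauto
  · have := (C.nx (m + 4) y).1 hy; tauto
  · have := (C.nw (m + 4) y).1 hy; tauto
  · have := (C.nw (m + 2) y).1 hy; tauto

lemma Chain.x_per (X : Ctx G 5 s) (hg : Eqb G s g) (C : Chain G g x w) (m : ℕ) :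
    x (m + 7) = x (m + 2) := by
  have h : G.Adj (w (m + 6)) (x (m + 7)) := (C.nw (m + 5) _).2 (Or.inr (Or.inl rfl))
  rw [C.w_per X hg, C.nw] at h
  rcases h with h | h | h | h | h
  · have := congrArg g h
    rw [C.col_iff] at this; omega
  · exact h
  all_goals
    have := congrArg g h
    simp only [C.gw, C.col_iff] at this
    omega

lemma per_mod {α : Type} (f : ℕ → α) (h : ∀ m, 2 ≤ m → f (m + 5) = f m) (n : ℕ) (hn : 2 ≤ n) :
    f n = f (n % 5 + 5) := by
  induction n using Nat.strong_induction_on with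
  | _ n ih =>
    by_cases h1 : n < 5
    · rw [Nat.mod_eq_of_lt h1, h n hn]
    by_cases h2 : n < 10
    · congr 1; omega
    obtain ⟨m, rfl⟩ : ∃ m, n = m + 5 := ⟨n - 5, by omega⟩
    rw [h m (by omega), ih m (by omega) (by omega)]
    congr 1; omega

/-- adjacency in the ten vertex graph -/
def ten : Fin 5 ⊕ Fin 5 → Fin 5 ⊕ Fin 5 → Bool
  | Sum.inl i, Sum.inl j => (j.val == (i.val + 1) % 5) || (i.val == (j.val + 1) % 5)
  | Sum.inl i, Sum.inr j => (j.val == i.val) || (i.val == (j.val + 1) % 5) ||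
      (i.val == (j.val + 2) % 5)
  | Sum.inr j, Sum.inl i => (j.val == i.val) || (i.val == (j.val + 1) % 5) ||
      (i.val == (j.val + 2) % 5)
  | Sum.inr i, Sum.inr j => (j.val == (i.val + 1) % 5) || (i.val == (j.val + 1) % 5)

set_option maxRecDepth 100000 in
lemma ten_indep : ∀ p q t : Fin 5 ⊕ Fin 5, p ≠ q → q ≠ t → p ≠ t →
    ten p q = true ∨ ten q t = true ∨ ten p t = true := by
  decide

theorem Chain.out (X : Ctx G 5 s) (hg : Eqb G s g) (C : Chain G g x w) :
    ∃ T : Finset V, T.Nonempty ∧ (∀ y ∈ T, ∀ z, G.Adj y z → z ∈ T) ∧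
      ∀ h : V → Fin 5, Pr G h → ∀ c, (T.filter (fun v => h v = c)).card = 2 := by
  have hx : ∀ n, 2 ≤ n → x n = x (n % 5 + 5) := by
    apply per_mod
    intro m hm
    obtain ⟨i, rfl⟩ : ∃ i, m = i + 2 := ⟨m - 2, by omega⟩
    exact C.x_per X hg i
  have hw : ∀ n, 2 ≤ n → w n = w (n % 5 + 5) := by
    apply per_mod
    intro m hm
    obtain ⟨i, rfl⟩ : ∃ i, m = i + 1 := ⟨m - 1, by omega⟩
    exact C.w_per X hg i
  let τ : Fin 5 ⊕ Fin 5 → V := Sum.elim (fun i => x (i.val + 5)) (fun i => w (i.val + 5))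
  have tx : ∀ n, 2 ≤ n → x n ∈ univ.image τ := by
    intro n hn
    rw [mem_image]
    exact ⟨Sum.inl ⟨n % 5, Nat.mod_lt _ (by norm_num)⟩, mem_univ _, (hx n hn).symm⟩
  have tw : ∀ n, 2 ≤ n → w n ∈ univ.image τ := by
    intro n hn
    rw [mem_image]
    exact ⟨Sum.inr ⟨n % 5, Nat.mod_lt _ (by norm_num)⟩, mem_univ _, (hw n hn).symm⟩
  have hxw : ∀ i j : Fin 5, x (i.val + 5) ≠ w (j.val + 5) := by
    intro i j h
    have h1 := congrArg g h
    rw [C.gw, C.col_iff] at h1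
    apply C.x_ne_w (j.val + 4)
    rw [← h.trans rfl, hx (j.val + 4 + 5) (by omega)]
    congr 1
    have := i.isLt
    omega
  have hinj : Function.Injective τ := by
    rintro (i | i) (j | j) h
    · have h1 := congrArg g h
      simp only [τ, Sum.elim_inl, C.col_iff] at h1
      congr 1; ext; omega
    · exact (hxw i j h).elim
    · exact (hxw j i h.symm).elim
    · have h1 := congrArg g h
      simp only [τ, Sum.elim_inr, C.gw, C.col_iff] at h1
      congr 1; ext; omega
  have axx : ∀ i j : Fin 5, j.val = (i.val + 1) % 5 → G.Adj (x (i.val + 5)) (x (j.val + 5)) := by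
    intro i j h
    rw [h, show (i.val + 1) % 5 = (i.val + 6) % 5 by omega, ← hx _ (by omega)]
    exact (C.nx (i.val + 3) _).2 (Or.inr (Or.inl rfl))
  have aww : ∀ i j : Fin 5, j.val = (i.val + 1) % 5 → G.Adj (w (i.val + 5)) (w (j.val + 5)) := by
    intro i j h
    rw [h, show (i.val + 1) % 5 = (i.val + 6) % 5 by omega, ← hw _ (by omega)]
    exact (C.nw (i.val + 4) _).2 (Or.inr (Or.inr (Or.inr (Or.inl rfl))))
  have axw : ∀ i j : Fin 5, (j.val = i.val ∨ i.val = (j.val + 1) % 5 ∨ i.val = (j.val + 2) % 5) →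
      G.Adj (w (j.val + 5)) (x (i.val + 5)) := by
    intro i j h
    rcases h with h | h | h
    · rw [h]; exact (C.nw (i.val + 4) _).2 (Or.inl rfl)
    · rw [h, show (j.val + 1) % 5 = (j.val + 6) % 5 by omega, ← hx _ (by omega)]
      exact (C.nw (j.val + 4) _).2 (Or.inr (Or.inl rfl))
    · rw [h, show (j.val + 2) % 5 = (j.val + 7) % 5 by omega, ← hx _ (by omega)]
      exact (C.nw (j.val + 4) _).2 (Or.inr (Or.inr (Or.inl rfl)))
  have hadj : ∀ p q, ten p q = true → G.Adj (τ p) (τ q) := by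
    rintro (i | i) (j | j) h
    · simp only [ten, Bool.or_eq_true, beq_iff_eq] at h
      rcases h with h | h
      · exact axx i j h
      · exact (axx j i h).symm
    · simp only [ten, Bool.or_eq_true, beq_iff_eq] at h
      exact (axw i j (by tauto)).symm
    · simp only [ten, Bool.or_eq_true, beq_iff_eq] at h
      exact axw j i (by tauto)
    · simp only [ten, Bool.or_eq_true, beq_iff_eq] at h
      rcases h with h | h
      · exact aww i j h
      · exact (aww j i h).symm
  refine ⟨univ.image τ, ⟨τ (Sum.inl 0), mem_image_of_mem _ (mem_univ _)⟩, ?_, ?_⟩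
  · intro y hy z hz
    rw [mem_image] at hy
    obtain ⟨i | i, _, rfl⟩ := hy
    · have hz : G.Adj (x (i.val + 3 + 2)) z := hz
      rw [C.nx] at hz
      rcases hz with rfl | rfl | rfl | rfl | rfl
      · exact tx _ (by omega)
      · exact tx _ (by omega)
      · exact tw _ (by omega)
      · exact tw _ (by omega)
      · exact tw _ (by omega)
    · have hz : G.Adj (w (i.val + 4 + 1)) z := hz
      rw [C.nw] at hz
      rcases hz with rfl | rfl | rfl | rfl | rfl
      · exact tx _ (by omega)
      · exact tx _ (by omega)
      · exact tx _ (by omega)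
      · exact tw _ (by omega)
      · exact tw _ (by omega)
  · intro h hp
    have hle : ∀ c ∈ (univ : Finset (Fin 5)),
        ((univ.image τ).filter (fun v => h v = c)).card ≤ 2 := by
      intro c _
      by_contra hcon
      push Not at hcon
      obtain ⟨a, ha, b, hb, d, hd, hab, had, hbd⟩ := two_lt_card.1 hcon
      simp only [mem_filter, mem_image, mem_univ, true_and] at ha hb hd
      obtain ⟨⟨p, rfl⟩, hp1⟩ := ha
      obtain ⟨⟨q, rfl⟩, hq1⟩ := hb
      obtain ⟨⟨t, rfl⟩, ht1⟩ := hd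
      rcases ten_indep p q t (fun e => hab (by rw [e])) (fun e => hbd (by rw [e]))
        (fun e => had (by rw [e])) with e | e | e
      · exact hp _ _ (hadj _ _ e) (hp1.trans hq1.symm)
      · exact hp _ _ (hadj _ _ e) (hq1.trans ht1.symm)
      · exact hp _ _ (hadj _ _ e) (hp1.trans ht1.symm)
    have hcard : (univ.image τ).card = 10 := by
      rw [card_image_of_injective _ hinj]; simp
    have hsum := card_eq_sum_card_fiberwise (f := h) (s := univ.image τ) (t := univ)
      (fun _ _ => mem_univ _)
    rw [hcard] at hsum
    have := (sum_eq_sum_iff_of_le hle).1 (by rw [← hsum]; simp)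
    intro c
    exact this c (mem_univ _)

end ten

theorem theoremS {V : Type} [Fintype V] [DecidableEq V] {G : SimpleGraph V} {k s : ℕ}
    {g : V → Fin k} (X : Ctx G k s) (hg : Eqb G s g) (hk : 3 ≤ k) (hodd : Odd k) (v : V) :
    ∃ T : Finset V, T.Nonempty ∧ (∀ y ∈ T, ∀ z, G.Adj y z → z ∈ T) ∧
      ∀ h : V → Fin k, Pr G h → ∀ c, (T.filter (fun v => h v = c)).card = 2 := by
  obtain ⟨x, u, w, t, B⟩ := exists_B X hg hk hodd v
  by_cases h3 : k = 3
  · subst h3; exact (three_main X hg B).elim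
  have h5 : 5 ≤ k := by
    obtain ⟨m, hm⟩ := hodd; omega
  have := k_eq_five X hg h5 hodd B
  subst this
  obtain ⟨x, w, C⟩ := get_chain X hg B
  exact C.out X hg

end EqCol
namespace EqCol

open Finset

section glue

variable {V : Type} [Fintype V] [DecidableEq V] {k : ℕ}

lemma sum_cls (g : V → Fin k) : ∑ c, cls g c = Fintype.card V := by
  have := card_eq_sum_card_fiberwise (f := g) (s := univ) (t := univ) (fun _ _ => mem_univ _)
  rw [card_univ] at this
  exact this.symm

/-- glue a colouring of the complement of `T` with one of `T` -/
def glue (T : Finset V) (c : {v // v ∉ T} → Fin k) (d : V → Fin k) (v : V) : Fin k :=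
  if h : v ∈ T then d v else c ⟨v, h⟩

lemma glue_in {T : Finset V} {c : {v // v ∉ T} → Fin k} {d : V → Fin k} {v : V} (h : v ∈ T) :
    glue T c d v = d v := by simp [glue, h]

lemma glue_out {T : Finset V} {c : {v // v ∉ T} → Fin k} {d : V → Fin k} {v : V} (h : v ∉ T) :
    glue T c d v = c ⟨v, h⟩ := by simp [glue, h]

lemma cls_glue (T : Finset V) (c : {v // v ∉ T} → Fin k) (d : V → Fin k) (l : Fin k) :
    cls (glue T c d) l = cls c l + (T.filter (fun v => d v = l)).card := by
  unfold cls
  have h1 : (univ.filter fun v => glue T c d v = l) =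
      ((univ.filter fun v => c v = l).map (Function.Embedding.subtype _)) ∪
        (T.filter (fun v => d v = l)) := by
    ext v
    simp only [mem_filter, mem_univ, true_and, mem_union, mem_map, Function.Embedding.subtype_apply,
      Subtype.exists, exists_and_right, exists_eq_right]
    by_cases h : v ∈ T
    · simp [glue_in h, h]
    · simp [glue_out h, h]
  rw [h1, card_union_of_disjoint, card_map]
  rw [disjoint_left]
  intro v hv hv'
  simp only [mem_map, Function.Embedding.subtype_apply, mem_filter] at hv hv'
  obtain ⟨y, _, rfl⟩ := hv
  exact y.2 hv'.1

lemma glue_self (T : Finset V) (f : V → Fin k) : glue T (fun v => f v.1) f = f := by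
  funext v
  by_cases h : v ∈ T
  · rw [glue_in h]
  · rw [glue_out h]

lemma cls_split (T : Finset V) (f : V → Fin k) (l : Fin k) :
    cls f l = cls (fun v : {v // v ∉ T} => f v.1) l + (T.filter (fun v => f v = l)).card := by
  conv_lhs => rw [← glue_self T f]
  exact cls_glue T _ f l

lemma card_compl_sub (T : Finset V) : Fintype.card {v // v ∉ T} + T.card = Fintype.card V := by
  rw [Fintype.card_subtype_compl, Fintype.card_coe]
  have := card_le_univ T
  omega

variable {G : SimpleGraph V}

lemma pr_glue {T : Finset V} {c : {v // v ∉ T} → Fin k} {d : V → Fin k}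
    (hc : Pr (G.comap (Subtype.val : {v // v ∉ T} → V)) c)
    (hd : ∀ a ∈ T, ∀ b ∈ T, G.Adj a b → d a ≠ d b)
    (hcr : ∀ a ∈ T, ∀ b (hb : b ∉ T), G.Adj a b → d a ≠ c ⟨b, hb⟩) : Pr G (glue T c d) := by
  intro a b hab
  by_cases ha : a ∈ T
  · by_cases hb : b ∈ T
    · rw [glue_in ha, glue_in hb]; exact hd a ha b hb hab
    · rw [glue_in ha, glue_out hb]; exact hcr a ha b hb hab
  · by_cases hb : b ∈ T
    · rw [glue_out ha, glue_in hb]; exact (hcr b hb a ha hab.symm).symm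
    · rw [glue_out ha, glue_out hb]; exact hc _ _ hab

lemma deg_sub (T : Finset V) (hdeg : ∀ v, (nb G v).card ≤ k) (v : {v // v ∉ T}) :
    (nb (G.comap (Subtype.val : {v // v ∉ T} → V)) v).card ≤ k := by
  refine le_trans ?_ (hdeg v.1)
  apply card_le_card_of_injOn (fun v => v.1)
  · intro w hw
    have := mem_nb.1 (mem_coe.1 hw)
    exact mem_coe.2 (mem_nb.2 this)
  · intro a _ b _ h; exact Subtype.ext h

lemma pr_sub (T : Finset V) {f : V → Fin k} (hf : Pr G f) :
    Pr (G.comap (Subtype.val : {v // v ∉ T} → V)) (fun v => f v.1) :=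
  fun a b hab => hf a.1 b.1 hab

/-- equitable colourability -/
def EqC {V : Type} [Fintype V] (G : SimpleGraph V) (k : ℕ) : Prop :=
  ∃ g : V → Fin k, Pr G g ∧ ∀ i j, cls g i ≤ cls g j + 1

lemma eq_of_balanced {g : V → Fin k} {s : ℕ} (hs : Fintype.card V = k * s)
    (hb : ∀ i j, cls g i ≤ cls g j + 1) : ∀ c, cls g c = s := by
  have hsum := sum_cls g
  by_contra hcon
  push Not at hcon
  obtain ⟨c, hc⟩ := hcon
  have hconst : ∑ _c : Fin k, s = k * s := by simp
  rcases lt_or_gt_of_ne hc with h | h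
  · have : ∑ c, cls g c < ∑ _c : Fin k, s := by
      apply sum_lt_sum
      · intro i _; have := hb i c; omega
      · exact ⟨c, mem_univ _, h⟩
    omega
  · have : ∑ _c : Fin k, s < ∑ c, cls g c := by
      apply sum_lt_sum
      · intro i _; have := hb c i; omega
      · exact ⟨c, mem_univ _, h⟩
    omega

end glue

section kkk

/-- the basic colouring of `K_{k,k}` -/
def baseCol (t : ℕ) (ht : 1 ≤ t) : Fin (2 * t + 1) ⊕ Fin (2 * t + 1) → Fin (2 * t + 1)
  | Sum.inl p => if p.val = 0 then ⟨0, by omega⟩ else ⟨(p.val + 1) / 2 + 1, by omega⟩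
  | Sum.inr p => if h : p.val < 3 then ⟨1, by omega⟩ else ⟨(p.val - 3) / 2 + t + 2, by omega⟩

lemma baseCol_inl (t : ℕ) (ht : 1 ≤ t) (p : Fin (2 * t + 1)) :
    (p.val = 0 ∧ (baseCol t ht (Sum.inl p)).val = 0) ∨
    (1 ≤ p.val ∧ (baseCol t ht (Sum.inl p)).val = (p.val + 1) / 2 + 1) := by
  by_cases h : p.val = 0
  · left; refine ⟨h, ?_⟩; simp only [baseCol]; rw [if_pos h]
  · right; refine ⟨by omega, ?_⟩; simp only [baseCol]; rw [if_neg h]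

lemma baseCol_inr (t : ℕ) (ht : 1 ≤ t) (p : Fin (2 * t + 1)) :
    (p.val < 3 ∧ (baseCol t ht (Sum.inr p)).val = 1) ∨
    (3 ≤ p.val ∧ (baseCol t ht (Sum.inr p)).val = (p.val - 3) / 2 + t + 2) := by
  by_cases h : p.val < 3
  · left; refine ⟨h, ?_⟩; simp only [baseCol]; rw [dif_pos h]
  · right; refine ⟨by omega, ?_⟩; simp only [baseCol]; rw [dif_neg h]

lemma baseCol_ne (t : ℕ) (ht : 1 ≤ t) (p q : Fin (2 * t + 1)) :
    baseCol t ht (Sum.inl p) ≠ baseCol t ht (Sum.inr q) := by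
  intro h
  have h := congrArg Fin.val h
  have h1 := baseCol_inl t ht p
  have h2 := baseCol_inr t ht q
  have := p.isLt
  have := q.isLt
  omega

lemma baseCol_cls (t : ℕ) (ht : 1 ≤ t) (c : Fin (2 * t + 1)) :
    cls (baseCol t ht) c = if c.val = 0 then 1 else if c.val = 1 then 3 else 2 := by
  have hle : ∀ c ∈ (univ : Finset (Fin (2 * t + 1))),
      cls (baseCol t ht) c ≤ if c.val = 0 then 1 else if c.val = 1 then 3 else 2 := by
    intro c _
    unfold cls
    split_ifs with h0 h1
    · rw [card_le_one]
      intro a ha b hb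
      rw [mem_filter] at ha hb
      have ha := congrArg Fin.val ha.2
      have hb := congrArg Fin.val hb.2
      rcases a with p | p <;> rcases b with q | q
      · have h1 := baseCol_inl t ht p
        have h2 := baseCol_inl t ht q
        congr 1; ext; omega
      · have h1 := baseCol_inl t ht p
        have h2 := baseCol_inr t ht q
        omega
      · have h1 := baseCol_inr t ht p
        have h2 := baseCol_inl t ht q
        omega
      · have h1 := baseCol_inr t ht p
        have h2 := baseCol_inr t ht q
        omega
    · have hsub : (univ.filter fun v => baseCol t ht v = c) ⊆
          {Sum.inr ⟨0, by omega⟩, Sum.inr ⟨1, by omega⟩, Sum.inr ⟨2, by omega⟩} := by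
        intro a ha
        rw [mem_filter] at ha
        have ha := congrArg Fin.val ha.2
        simp only [mem_insert, mem_singleton]
        rcases a with p | p
        · have h1 := baseCol_inl t ht p
          omega
        · have h1 := baseCol_inr t ht p
          have : p.val = 0 ∨ p.val = 1 ∨ p.val = 2 := by omega
          rcases this with h | h | h
          · left; congr 1; ext; exact h
          · right; left; congr 1; ext; exact h
          · right; right; congr 1; ext; exact h
      exact le_trans (card_le_card hsub) card_le_three
    · by_contra hcon
      push Not at hcon
      obtain ⟨a, ha, b, hb, d, hd, hab, had, hbd⟩ := two_lt_card.1 hcon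
      rw [mem_filter] at ha hb hd
      have ha := congrArg Fin.val ha.2
      have hb := congrArg Fin.val hb.2
      have hd := congrArg Fin.val hd.2
      rcases a with p | p <;> rcases b with q | q <;> rcases d with r | r
      all_goals
        simp only [ne_eq, Sum.inl.injEq, Sum.inr.injEq, Fin.ext_iff] at hab had hbd
        have h1 := baseCol_inl t ht p
        have h2 := baseCol_inl t ht q
        have h3 := baseCol_inl t ht r
        have h4 := baseCol_inr t ht p
        have h5 := baseCol_inr t ht q
        have h6 := baseCol_inr t ht r
        have := p.isLt
        have := q.isLt
        have := r.isLt
        omega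
  have hs := sum_cls (baseCol t ht)
  have hs2 : ∑ c : Fin (2 * t + 1), (if c.val = 0 then 1 else if c.val = 1 then 3 else 2)
      = 2 * (2 * t + 1) := by
    obtain ⟨m, rfl⟩ : ∃ m, t = m + 1 := ⟨t - 1, by omega⟩
    rw [Fin.sum_univ_eq_sum_range (fun i => if i = 0 then 1 else if i = 1 then 3 else 2)
      (2 * (m + 1) + 1), show 2 * (m + 1) + 1 = (2 * m + 1) + 1 + 1 by ring, sum_range_succ',
      sum_range_succ']
    simp
    ring
  have := (sum_eq_sum_iff_of_le hle).1 (by rw [hs, hs2]; simp; ring)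
  exact this c (mem_univ _)

end kkk

end EqCol
namespace EqCol

open Finset

section comb

lemma perm_two {k : ℕ} {a b i j : Fin k} (hab : a ≠ b) (hij : i ≠ j) :
    ∃ σ : Equiv.Perm (Fin k), σ a = i ∧ σ b = j := by
  refine ⟨Equiv.swap (Equiv.swap a i b) j * Equiv.swap a i, ?_, ?_⟩
  · rw [Equiv.Perm.mul_apply, Equiv.swap_apply_left]
    apply Equiv.swap_apply_of_ne_of_ne
    · intro h
      apply hab
      have : Equiv.swap a i a = Equiv.swap a i b := by rw [Equiv.swap_apply_left]; exact h
      exact (Equiv.swap a i).injective this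
    · exact hij
  · rw [Equiv.Perm.mul_apply, Equiv.swap_apply_left]

lemma cls_recolor {W : Type} [Fintype W] {k : ℕ} (d : W → Fin k) (σ : Equiv.Perm (Fin k))
    (c : Fin k) : cls (fun w => σ (d w)) (σ c) = cls d c := by
  unfold cls
  congr 1
  ext w
  simp

lemma kkCol {k : ℕ} (hk : 3 ≤ k) (hodd : Odd k) {i j : Fin k} (hij : i ≠ j) :
    ∃ d : Fin k ⊕ Fin k → Fin k, (∀ p q, d (Sum.inl p) ≠ d (Sum.inr q)) ∧
      cls d i = 1 ∧ cls d j = 3 ∧ ∀ l, l ≠ i → l ≠ j → cls d l = 2 := by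
  obtain ⟨t, rfl⟩ := hodd
  have ht : 1 ≤ t := by omega
  obtain ⟨σ, h0, h1⟩ := perm_two (a := (⟨0, by omega⟩ : Fin (2 * t + 1)))
    (b := ⟨1, by omega⟩) (by simp) hij
  refine ⟨fun w => σ (baseCol t ht w), ?_, ?_, ?_, ?_⟩
  · intro p q h
    exact baseCol_ne t ht p q (σ.injective h)
  · rw [← h0, cls_recolor, baseCol_cls]; simp
  · rw [← h1, cls_recolor, baseCol_cls]; simp
  · intro l hli hlj
    obtain ⟨l, rfl⟩ := σ.surjective l
    rw [cls_recolor, baseCol_cls]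
    rw [if_neg, if_neg]
    · intro h; apply hlj; rw [← h1]; congr 1; ext; exact h
    · intro h; apply hli; rw [← h0]; congr 1; ext; exact h

variable {V : Type} [Fintype V] [DecidableEq V] {k : ℕ}

/-- `f` embeds `K_{k,k}` into `G` -/
structure KK (G : SimpleGraph V) (f : Fin k ⊕ Fin k → V) : Prop where
  inj : Function.Injective f
  adj : ∀ i j, G.Adj (f (Sum.inl i)) (f (Sum.inr j))

variable {G : SimpleGraph V} {f : Fin k ⊕ Fin k → V}

lemma KK.nb_inl (h : KK G f) (hdeg : ∀ v, (nb G v).card ≤ k) (p : Fin k) {z : V}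
    (hz : G.Adj (f (Sum.inl p)) z) : ∃ q, z = f (Sum.inr q) := by
  have hsub : univ.image (fun q => f (Sum.inr q)) ⊆ nb G (f (Sum.inl p)) := by
    intro y hy
    rw [mem_image] at hy
    obtain ⟨q, _, rfl⟩ := hy
    exact mem_nb.2 (h.adj p q)
  have hcard : (univ.image (fun q => f (Sum.inr q))).card = k := by
    exact (card_image_of_injective _ (h.inj.comp Sum.inr_injective)).trans (by simp)
  have := eq_of_subset_of_card_le hsub (by rw [hcard]; exact hdeg _)
  have hz' := mem_nb.2 hz
  rw [← this, mem_image] at hz'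
  obtain ⟨q, _, hq⟩ := hz'
  exact ⟨q, hq.symm⟩

lemma KK.nb_inr (h : KK G f) (hdeg : ∀ v, (nb G v).card ≤ k) (p : Fin k) {z : V}
    (hz : G.Adj (f (Sum.inr p)) z) : ∃ q, z = f (Sum.inl q) := by
  have hsub : univ.image (fun q => f (Sum.inl q)) ⊆ nb G (f (Sum.inr p)) := by
    intro y hy
    rw [mem_image] at hy
    obtain ⟨q, _, rfl⟩ := hy
    exact mem_nb.2 (h.adj q p).symm
  have hcard : (univ.image (fun q => f (Sum.inl q))).card = k := by
    exact (card_image_of_injective _ (h.inj.comp Sum.inl_injective)).trans (by simp)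
  have := eq_of_subset_of_card_le hsub (by rw [hcard]; exact hdeg _)
  have hz' := mem_nb.2 hz
  rw [← this, mem_image] at hz'
  obtain ⟨q, _, hq⟩ := hz'
  exact ⟨q, hq.symm⟩

lemma KK.card_T (h : KK G f) : (univ.image f).card = 2 * k := by
  rw [card_image_of_injective _ h.inj]; simp; ring

lemma KK.not_adj (h : KK G f) (hdeg : ∀ v, (nb G v).card ≤ k) (p : Fin k ⊕ Fin k) {b : V}
    (hb : b ∉ univ.image f) : ¬ G.Adj (f p) b := by
  intro hab
  apply hb
  rcases p with p | p
  · obtain ⟨q, rfl⟩ := h.nb_inl hdeg p hab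
    exact mem_image_of_mem _ (mem_univ _)
  · obtain ⟨q, rfl⟩ := h.nb_inr hdeg p hab
    exact mem_image_of_mem _ (mem_univ _)

lemma KK.comb (h : KK G f) (hdeg : ∀ v, (nb G v).card ≤ k) (hk : 3 ≤ k) (hodd : Odd k)
    {c : {v // v ∉ univ.image f} → Fin k}
    (hc : Pr (G.comap (Subtype.val : {v // v ∉ univ.image f} → V)) c) {i j : Fin k} (hij : i ≠ j) :
    ∃ g : V → Fin k, Pr G g ∧ cls g i = cls c i + 1 ∧ cls g j = cls c j + 3 ∧
      ∀ l, l ≠ i → l ≠ j → cls g l = cls c l + 2 := by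
  obtain ⟨d, hd, di, dj, dl⟩ := kkCol hk hodd hij
  have hext : ∀ p, Function.extend f d (fun _ => i) (f p) = d p := fun p => h.inj.extend_apply _ _ _
  have hcls : ∀ l, cls (glue (univ.image f) c (Function.extend f d (fun _ => i))) l =
      cls c l + cls d l := by
    intro l
    rw [cls_glue]
    congr 1
    unfold cls
    rw [← card_image_of_injective (univ.filter fun v => d v = l) h.inj]
    congr 1
    ext v
    simp only [mem_filter, mem_image, mem_univ, true_and]
    constructor
    · rintro ⟨⟨p, rfl⟩, hp⟩
      rw [hext] at hp
      exact ⟨p, hp, rfl⟩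
    · rintro ⟨p, hp, rfl⟩
      exact ⟨⟨p, rfl⟩, by rw [hext]; exact hp⟩
  refine ⟨glue (univ.image f) c (Function.extend f d (fun _ => i)), ?_, ?_, ?_, ?_⟩
  · apply pr_glue hc
    · intro a ha b hb hab
      rw [mem_image] at ha hb
      obtain ⟨p, _, rfl⟩ := ha
      obtain ⟨q, _, rfl⟩ := hb
      rw [hext, hext]
      rcases p with p | p
      · obtain ⟨q', hq⟩ := h.nb_inl hdeg p hab
        rw [h.inj hq]
        exact hd _ _
      · obtain ⟨q', hq⟩ := h.nb_inr hdeg p hab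
        rw [h.inj hq]
        exact (hd _ _).symm
    · intro a ha b hb hab
      rw [mem_image] at ha
      obtain ⟨p, _, rfl⟩ := ha
      exact absurd hab (h.not_adj hdeg p hb)
  · rw [hcls, di]
  · rw [hcls, dj]
  · intro l h1 h2; rw [hcls, dl l h1 h2]

end comb

/-- Statement (A), for fixed `k` -/
def HypA (k n : ℕ) : Prop :=
  ∀ (V : Type) [Fintype V] (G : SimpleGraph V), Fintype.card V ≤ n → (∃ f : V → Fin k, Pr G f) →
    (∀ v, (nb G v).card ≤ k) → ¬ EqC G k →
    ∃ f : Fin k ⊕ Fin k → V, Function.Injective f ∧ ∀ i j, G.Adj (f (Sum.inl i)) (f (Sum.inr j))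

lemma thmZ {k n : ℕ} (hA : HypA k n) (hk : 3 ≤ k) (hodd : Odd k) (s : ℕ) :
    ∀ (V : Type) [Fintype V] (G : SimpleGraph V), Fintype.card V = k * s → Fintype.card V ≤ n →
    (∃ f : V → Fin k, Pr G f) → (∀ v, (nb G v).card ≤ k) →
    (∃ g : V → Fin k, Eqb G s g) ∨ NE G k s := by
  induction s using Nat.strong_induction_on with
  | _ s ih =>
  intro V _ G hcard hn hcol hdeg
  classical
  by_cases hE : EqC G k
  · obtain ⟨g, hg, hb⟩ := hE
    exact Or.inl ⟨g, hg, eq_of_balanced hcard hb⟩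
  obtain ⟨f, hinj, hadj⟩ := hA V G hn hcol hdeg hE
  have h : KK G f := ⟨hinj, hadj⟩
  have hT := card_compl_sub (univ.image f)
  rw [h.card_T] at hT
  have hs2 : 2 ≤ s := by
    have : k * 2 ≤ k * s := by omega
    exact Nat.le_of_mul_le_mul_left this (by omega)
  obtain ⟨r, rfl⟩ : ∃ r, s = r + 2 := ⟨s - 2, by omega⟩
  have hcard' : Fintype.card {v // v ∉ univ.image f} = k * r := by
    rw [hcard] at hT
    have : k * (r + 2) = k * r + 2 * k := by ring
    omega
  obtain ⟨f0, hf0⟩ := hcol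
  rcases ih r (by omega) {v // v ∉ univ.image f} (G.comap Subtype.val) hcard' (by omega)
    ⟨_, pr_sub _ hf0⟩ (deg_sub _ hdeg) with ⟨c, hc, hcc⟩ | ⟨c, hc, i, j, hij, hi, hj, hl⟩
  · right
    have hij : (⟨1, by omega⟩ : Fin k) ≠ ⟨0, by omega⟩ := by simp
    obtain ⟨g, hg, g1, g2, g3⟩ := h.comb hdeg hk hodd hc hij.symm
    refine ⟨g, hg, _, _, hij, ?_, ?_, ?_⟩
    · rw [g2, hcc]
    · rw [g1, hcc]
    · intro l h1 h2; rw [g3 l h2 h1, hcc]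
  · left
    obtain ⟨g, hg, g1, g2, g3⟩ := h.comb hdeg hk hodd hc hij
    refine ⟨g, hg, ?_⟩
    intro l
    by_cases h1 : l = i
    · subst h1; omega
    by_cases h2 : l = j
    · subst h2; omega
    rw [g3 l h1 h2, hl l h1 h2]

end EqCol
namespace EqCol

open Finset

lemma thmZ2 {k n : ℕ} (hA : HypA k n) (hk : 3 ≤ k) (hodd : Odd k) (N : ℕ) :
    ∀ (V : Type) [Fintype V] (G : SimpleGraph V), Fintype.card V = N → ¬ k ∣ N →
    Fintype.card V ≤ n →
    (∃ f : V → Fin k, Pr G f) → (∀ v, (nb G v).card ≤ k) → EqC G k := by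
  induction N using Nat.strong_induction_on with
  | _ N ih =>
  intro V _ G hcard hdvd hn hcol hdeg
  classical
  by_contra hE
  obtain ⟨f, hinj, hadj⟩ := hA V G hn hcol hdeg hE
  have h : KK G f := ⟨hinj, hadj⟩
  have hT := card_compl_sub (univ.image f)
  rw [h.card_T] at hT
  obtain ⟨f0, hf0⟩ := hcol
  obtain ⟨c, hc, hb⟩ := ih (Fintype.card {v // v ∉ univ.image f}) (by omega)
    {v // v ∉ univ.image f} (G.comap Subtype.val) rfl (by
      intro hd
      apply hdvd
      rw [← hcard, ← hT]
      exact dvd_add hd (Dvd.intro_left 2 rfl)) (by omega) ⟨_, pr_sub _ hf0⟩ (deg_sub _ hdeg)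
  have hex : ∃ i j, cls c i = cls c j + 1 := by
    by_contra hcon
    push Not at hcon
    apply hdvd
    have heq : ∀ i, cls c i = cls c ⟨0, by omega⟩ := by
      intro i
      have h1 := hb i ⟨0, by omega⟩
      have h2 := hb ⟨0, by omega⟩ i
      have h3 := hcon i ⟨0, by omega⟩
      have h4 := hcon ⟨0, by omega⟩ i
      omega
    have hsum := sum_cls c
    rw [sum_congr rfl (fun i _ => heq i)] at hsum
    simp only [sum_const, card_univ, Fintype.card_fin, smul_eq_mul] at hsum
    rw [← hcard, ← hT, ← hsum]
    exact dvd_add (Dvd.intro _ rfl) (Dvd.intro_left 2 rfl)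
  obtain ⟨i, j, hij⟩ := hex
  have hne : i ≠ j := by rintro rfl; omega
  obtain ⟨g, hg, g1, g2, g3⟩ := h.comb hdeg hk hodd hc hne
  apply hE
  have hval : ∀ l, cls g l = cls c j + 2 ∨ cls g l = cls c j + 3 := by
    intro l
    by_cases h1 : l = i
    · subst h1; omega
    by_cases h2 : l = j
    · subst h2; omega
    have := g3 l h1 h2
    have := hb l j
    have := hb i l
    omega
  refine ⟨g, hg, ?_⟩
  intro a b
  have := hval a
  have := hval b
  omega

lemma hall_ext {V : Type} [DecidableEq V] {k : ℕ} (K : Finset V) (hK : K.card = k)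
    (t : V → Finset (Fin k)) (ht : ∀ v ∈ K, k ≤ (t v).card + 1)
    (hk : 0 < k) (hall : ∀ l, ∃ v ∈ K, l ∈ t v) :
    ∃ d : V → Fin k, (∀ a ∈ K, ∀ b ∈ K, a ≠ b → d a ≠ d b) ∧ ∀ a ∈ K, d a ∈ t a := by
  have key : ∀ S : Finset {v // v ∈ K}, S.card ≤ (S.biUnion (fun v => t v.1)).card := by
    intro S
    by_cases hS : S = univ
    · have : S.biUnion (fun v => t v.1) = univ := by
        ext l
        simp only [mem_biUnion, mem_univ, iff_true]
        obtain ⟨v, hv, hl⟩ := hall l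
        exact ⟨⟨v, hv⟩, by rw [hS]; exact mem_univ _, hl⟩
      rw [this, hS]
      simp [hK]
    · rcases S.eq_empty_or_nonempty with h | ⟨v, hv⟩
      · subst h; simp
      have h1 : S.card < k := by
        have := card_lt_univ_of_notMem (s := S) (x := (by
          have : ∃ x, x ∉ S := by
            by_contra hcon; push Not at hcon; exact hS (eq_univ_of_forall hcon)
          exact this.choose)) (by
          have : ∃ x, x ∉ S := by
            by_contra hcon; push Not at hcon; exact hS (eq_univ_of_forall hcon)
          exact this.choose_spec)
        simpa [hK] using this
      have h2 := ht v.1 v.2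
      have h3 : (t v.1).card ≤ (S.biUnion (fun v => t v.1)).card :=
        card_le_card (subset_biUnion_of_mem (fun v : {v // v ∈ K} => t v.1) hv)
      omega
  obtain ⟨e, he, het⟩ := (all_card_le_biUnion_card_iff_exists_injective _).1 key
  refine ⟨fun v => if h : v ∈ K then e ⟨v, h⟩ else ⟨0, hk⟩, ?_, ?_⟩
  · intro a ha b hb hab h
    simp only [ha, hb, dif_pos] at h
    exact hab (congrArg Subtype.val (he h))
  · intro a ha
    simp only [ha, dif_pos]
    exact het _

end EqCol
namespace EqCol

open Finset

section cl

variable {V : Type} [Fintype V] [DecidableEq V] {k : ℕ} {G : SimpleGraph V}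

lemma exists_col {K : Finset V} (hK : K.card = k) {d : V → Fin k}
    (hd : ∀ a ∈ K, ∀ b ∈ K, a ≠ b → d a ≠ d b) (l : Fin k) : ∃ a ∈ K, d a = l := by
  have h1 : (K.image d).card = k := by
    rw [card_image_of_injOn, hK]
    intro a ha b hb hab
    by_contra hne
    exact hd a ha b hb hne hab
  have h2 : K.image d = univ := by
    apply eq_univ_of_card; rw [h1]; simp
  have : l ∈ K.image d := by rw [h2]; exact mem_univ _
  rw [mem_image] at this
  exact this

lemma filter_one {K : Finset V} (hK : K.card = k) {d : V → Fin k}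
    (hd : ∀ a ∈ K, ∀ b ∈ K, a ≠ b → d a ≠ d b) (l : Fin k) :
    (K.filter (fun v => d v = l)).card = 1 := by
  obtain ⟨a, ha, hal⟩ := exists_col hK hd l
  rw [card_eq_one]
  refine ⟨a, ?_⟩
  ext b
  simp only [mem_filter, mem_singleton]
  constructor
  · rintro ⟨hb, hbl⟩
    by_contra hne
    exact hd b hb a ha hne (hbl.trans hal.symm)
  · rintro rfl; exact ⟨ha, hal⟩

lemma out_unique {K : Finset V} (hK : K.card = k)
    (hcl : ∀ a ∈ K, ∀ b ∈ K, a ≠ b → G.Adj a b) (hdeg : ∀ v, (nb G v).card ≤ k)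
    {v z z' : V} (hv : v ∈ K) (hz : z ∉ K) (hz' : z' ∉ K) (h : G.Adj v z) (h' : G.Adj v z') :
    z = z' := by
  by_contra hne
  have hsub : insert z (insert z' (K.erase v)) ⊆ nb G v := by
    intro y hy
    rw [mem_insert, mem_insert, mem_erase] at hy
    rw [mem_nb]
    rcases hy with rfl | rfl | ⟨h1, h2⟩
    · exact h
    · exact h'
    · exact hcl v hv y h2 (Ne.symm h1)
  have := card_le_card hsub
  rw [card_insert_of_notMem, card_insert_of_notMem, card_erase_of_mem hv] at this
  · have h1 := hdeg v
    have : 0 < K.card := card_pos.2 ⟨v, hv⟩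
    omega
  · intro hh; exact hz' (mem_of_mem_erase hh)
  · intro hh
    rw [mem_insert] at hh
    rcases hh with hh | hh
    · exact hne hh
    · exact hz (mem_of_mem_erase hh)

lemma clique_ext {K : Finset V} (hK : K.card = k) (hk : 0 < k)
    (hcl : ∀ a ∈ K, ∀ b ∈ K, a ≠ b → G.Adj a b) (hdeg : ∀ v, (nb G v).card ≤ k)
    {c : {v // v ∉ K} → Fin k} (hc : Pr (G.comap (Subtype.val : {v // v ∉ K} → V)) c)
    (hall : ∀ l, ∃ v ∈ K, ∀ b (hb : b ∉ K), G.Adj v b → c ⟨b, hb⟩ ≠ l) :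
    ∃ h : V → Fin k, Pr G h ∧ ∀ l, cls h l = cls c l + 1 := by
  classical
  obtain ⟨d, hd, hdt⟩ := hall_ext K hK
    (fun v => univ.filter (fun l => ∀ b (hb : b ∉ K), G.Adj v b → c ⟨b, hb⟩ ≠ l)) (by
      intro v hv
      by_cases hex : ∃ b, b ∉ K ∧ G.Adj v b
      · obtain ⟨b, hb, hvb⟩ := hex
        have : univ.erase (c ⟨b, hb⟩) ⊆
            univ.filter (fun l => ∀ b (hb : b ∉ K), G.Adj v b → c ⟨b, hb⟩ ≠ l) := by
          intro l hl
          rw [mem_filter]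
          refine ⟨mem_univ _, ?_⟩
          intro b' hb' hvb'
          have := out_unique hK hcl hdeg hv hb hb' hvb hvb'
          subst this
          exact (ne_of_mem_erase hl).symm
        have := card_le_card this
        rw [card_erase_of_mem (mem_univ _)] at this
        simp only [card_univ, Fintype.card_fin] at this
        omega
      · have : univ.filter (fun l => ∀ b (hb : b ∉ K), G.Adj v b → c ⟨b, hb⟩ ≠ l) = univ := by
          ext l
          simp only [mem_filter, mem_univ, true_and, iff_true]
          intro b hb hvb
          exact absurd ⟨b, hb, hvb⟩ hex
        rw [this]; simp) hk (by
      intro l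
      obtain ⟨v, hv, h⟩ := hall l
      exact ⟨v, hv, by rw [mem_filter]; exact ⟨mem_univ _, h⟩⟩)
  refine ⟨glue K c d, pr_glue hc ?_ ?_, ?_⟩
  · intro a ha b hb hab; exact hd a ha b hb hab.ne
  · intro a ha b hb hab
    have := hdt a ha
    rw [mem_filter] at this
    exact (this.2 b hb hab).symm
  · intro l
    rw [cls_glue, filter_one hK hd]

lemma deg_drop (K : Finset V) (hdeg : ∀ v, (nb G v).card ≤ k) (x : {v // v ∉ K}) {v : V}
    (hv : v ∈ K) (hvx : G.Adj v x.1) :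
    (nb (G.comap (Subtype.val : {v // v ∉ K} → V)) x).card + 1 ≤ k := by
  refine le_trans ?_ (hdeg x.1)
  have hsub : insert v ((nb (G.comap (Subtype.val : {v // v ∉ K} → V)) x).image Subtype.val) ⊆
      nb G x.1 := by
    intro y hy
    rw [mem_insert, mem_image] at hy
    rcases hy with rfl | ⟨y, hy, rfl⟩
    · exact mem_nb.2 hvx.symm
    · have := mem_nb.1 hy
      exact mem_nb.2 this
  have := card_le_card hsub
  rw [card_insert_of_notMem, card_image_of_injective _ Subtype.val_injective] at this
  · exact this
  · intro hh
    rw [mem_image] at hh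
    obtain ⟨y, _, rfl⟩ := hh
    exact y.2 hv

lemma deg_edge (K : Finset V) (hdeg : ∀ v, (nb G v).card ≤ k) (x y : {v // v ∉ K}) {v w : V}
    (hv : v ∈ K) (hvx : G.Adj v x.1) (hw : w ∈ K) (hwy : G.Adj w y.1) (u : {v // v ∉ K}) :
    (nb ((G.comap (Subtype.val : {v // v ∉ K} → V)) ⊔ SimpleGraph.edge x y) u).card ≤ k := by
  by_cases hux : u = x
  · subst hux
    have hsub : nb ((G.comap (Subtype.val : {v // v ∉ K} → V)) ⊔ SimpleGraph.edge u y) u ⊆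
        insert y (nb (G.comap (Subtype.val : {v // v ∉ K} → V)) u) := by
      intro a ha
      rw [mem_nb, SimpleGraph.sup_adj, SimpleGraph.edge_adj] at ha
      rw [mem_insert, mem_nb]
      rcases ha with ha | ⟨⟨_, h⟩ | ⟨h1, h2⟩, _⟩
      · exact Or.inr ha
      · exact Or.inl h
      · exact Or.inl (h2.trans h1)
    exact (card_le_card hsub).trans ((card_insert_le _ _).trans (deg_drop K hdeg u hv hvx))
  by_cases huy : u = y
  · subst huy
    have hsub : nb ((G.comap (Subtype.val : {v // v ∉ K} → V)) ⊔ SimpleGraph.edge x u) u ⊆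
        insert x (nb (G.comap (Subtype.val : {v // v ∉ K} → V)) u) := by
      intro a ha
      rw [mem_nb, SimpleGraph.sup_adj, SimpleGraph.edge_adj] at ha
      rw [mem_insert, mem_nb]
      rcases ha with ha | ⟨⟨h1, h2⟩ | ⟨h1, h2⟩, _⟩
      · exact Or.inr ha
      · exact absurd h1 hux
      · exact Or.inl h2
    exact (card_le_card hsub).trans ((card_insert_le _ _).trans (deg_drop K hdeg u hw hwy))
  · refine le_trans (card_le_card ?_) (deg_sub K hdeg u)
    intro a ha
    rw [mem_nb, SimpleGraph.sup_adj, SimpleGraph.edge_adj] at ha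
    rw [mem_nb]
    rcases ha with ha | ⟨⟨h1, h2⟩ | ⟨h1, h2⟩, _⟩
    · exact ha
    · exact absurd h1 hux
    · exact absurd h1 huy

lemma NE_shift {W : Type} [Fintype W] {r m : ℕ} {h : V → Fin k} (hh : Pr G h)
    {c : W → Fin k} (hcl : ∀ l, cls h l = cls c l + m)
    (hc : ∃ i j, i ≠ j ∧ cls c i = r + 1 ∧ cls c j + 1 = r ∧
      ∀ l, l ≠ i → l ≠ j → cls c l = r) : NE G k (r + m) := by
  obtain ⟨i, j, hij, h1, h2, h3⟩ := hc
  refine ⟨h, hh, i, j, hij, ?_, ?_, ?_⟩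
  · rw [hcl, h1]; ring
  · rw [hcl, ← h2]; ring
  · intro l hi hj; rw [hcl, h3 l hi hj]

end cl

lemma thmQ {k n : ℕ} (hA : HypA k n) (hk : 3 ≤ k) (hodd : Odd k) (s : ℕ) :
    ∀ (V : Type) [Fintype V] (G : SimpleGraph V), Fintype.card V = k * s →
    Fintype.card V ≤ n → (∀ v, (nb G v).card ≤ k) → ∀ f : V → Fin k, Pr G f →
    (∃ l, cls f l ≠ s) → NE G k s := by
  induction s using Nat.strong_induction_on with
  | _ s ih =>
  intro V _ G hcard hn hdeg f hf ⟨l, hl⟩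
  classical
  by_contra hNE
  obtain ⟨g, hg⟩ : ∃ g : V → Fin k, Eqb G s g :=
    (thmZ hA hk hodd s V G hcard hn ⟨f, hf⟩ hdeg).resolve_right hNE
  by_cases hclq : ∃ K : Finset V, K.card = k ∧ ∀ a ∈ K, ∀ b ∈ K, a ≠ b → G.Adj a b
  · obtain ⟨K, hK, hcl⟩ := hclq
    have hT := card_compl_sub K
    rw [hK, hcard] at hT
    have hs1 : 1 ≤ s := by
      rcases Nat.eq_zero_or_pos s with h | h
      · subst h; omega
      · exact h
    obtain ⟨r, rfl⟩ : ∃ r, s = r + 1 := ⟨s - 1, by omega⟩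
    have hcard' : Fintype.card {v // v ∉ K} = k * r := by
      have : k * (r + 1) = k * r + k := by ring
      omega
    have hfK : ∀ a ∈ K, ∀ b ∈ K, a ≠ b → f a ≠ f b := fun a ha b hb hab =>
      hf a b (hcl a ha b hb hab)
    have hlf : cls (fun v : {v // v ∉ K} => f v.1) l ≠ r := by
      have := cls_split K f l
      rw [filter_one hK hfK] at this
      omega
    by_cases h1 : ∃ v0 ∈ K, ∀ b, b ∉ K → ¬ G.Adj v0 b
    · obtain ⟨v0, hv0, hv0b⟩ := h1
      obtain ⟨c, hc, hcc⟩ := ih r (by omega) {v // v ∉ K} (G.comap Subtype.val) hcard'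
        (by omega) (deg_sub K hdeg) _ (pr_sub K hf) ⟨l, hlf⟩
      obtain ⟨h, hh, hhc⟩ := clique_ext hK (by omega) hcl hdeg hc
        (fun l => ⟨v0, hv0, fun b hb hab => absurd hab (hv0b b hb)⟩)
      exact hNE (NE_shift hh hhc hcc)
    · push Not at h1
      obtain ⟨v1, hv1⟩ : K.Nonempty := by rw [← card_pos]; omega
      obtain ⟨z1, hz1, ha1⟩ := h1 v1 hv1
      obtain ⟨v2, hv2, hv2c⟩ := exists_col hK hfK (f z1)
      obtain ⟨z2, hz2, ha2⟩ := h1 v2 hv2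
      have hfz : f z1 ≠ f z2 := by
        rw [← hv2c]; exact hf _ _ ha2
      have hzne : (⟨z1, hz1⟩ : {v // v ∉ K}) ≠ ⟨z2, hz2⟩ := by
        intro h; exact hfz (congrArg f (congrArg Subtype.val h))
      have hdeg' : ∀ v, (nb ((G.comap (Subtype.val : {v // v ∉ K} → V)) ⊔
          SimpleGraph.edge ⟨z1, hz1⟩ ⟨z2, hz2⟩) v).card ≤ k :=
        deg_edge K hdeg _ _ hv1 ha1 hv2 ha2
      have hpr' : Pr ((G.comap (Subtype.val : {v // v ∉ K} → V)) ⊔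
          SimpleGraph.edge ⟨z1, hz1⟩ ⟨z2, hz2⟩) (fun v => f v.1) := by
        intro a b hab
        rw [SimpleGraph.sup_adj, SimpleGraph.edge_adj] at hab
        rcases hab with hab | ⟨⟨rfl, rfl⟩ | ⟨rfl, rfl⟩, _⟩
        · exact hf _ _ hab
        · exact hfz
        · exact hfz.symm
      obtain ⟨c, hc, hcc⟩ := ih r (by omega) {v // v ∉ K} _ hcard'
        (by omega) hdeg' _ hpr' ⟨l, hlf⟩
      have hcz : c ⟨z1, hz1⟩ ≠ c ⟨z2, hz2⟩ := by
        apply hc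
        rw [SimpleGraph.sup_adj, SimpleGraph.edge_adj]
        right
        exact ⟨Or.inl ⟨rfl, rfl⟩, hzne⟩
      have hc' : Pr (G.comap (Subtype.val : {v // v ∉ K} → V)) c := by
        intro a b hab
        apply hc
        rw [SimpleGraph.sup_adj]
        exact Or.inl hab
      obtain ⟨h, hh, hhc⟩ := clique_ext hK (by omega) hcl hdeg hc' (by
        intro l
        by_cases h : c ⟨z1, hz1⟩ = l
        · refine ⟨v2, hv2, ?_⟩
          intro b hb hab
          have := out_unique hK hcl hdeg hv2 hb hz2 hab ha2
          subst this
          intro h'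
          exact hcz (h.trans h'.symm)
        · refine ⟨v1, hv1, ?_⟩
          intro b hb hab
          have := out_unique hK hcl hdeg hv1 hb hz1 hab ha1
          subst this
          exact h)
      exact hNE (NE_shift hh hhc hcc)
  · have X : Ctx G k s := ⟨hdeg, fun T hT h => hclq ⟨T, hT, h⟩, hNE⟩
    have hnV : Nonempty V := by
      by_contra hV
      rw [not_nonempty_iff] at hV
      have h0 : cls f l = 0 := by
        unfold cls
        simp
      rw [Fintype.card_eq_zero] at hcard
      have : s = 0 := by
        rcases Nat.eq_zero_or_pos s with h | h
        · exact h
        · have := Nat.mul_pos (show 0 < k by omega) h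
          omega
      omega
    obtain ⟨v⟩ := hnV
    obtain ⟨T, hTne, hTcl, hT2⟩ := theoremS X hg hk hodd v
    have hsg := fun l => cls_split T g l
    have hs2 : 2 ≤ s := by
      have := hsg l
      rw [hT2 g hg.1, hg.2] at this
      omega
    obtain ⟨r, rfl⟩ : ∃ r, s = r + 2 := ⟨s - 2, by omega⟩
    have hgr : ∀ l, cls (fun v : {v // v ∉ T} => g v.1) l = r := by
      intro l
      have := hsg l
      rw [hT2 g hg.1, hg.2] at this
      omega
    have hcard' : Fintype.card {v // v ∉ T} = k * r := by
      rw [← sum_cls (fun v : {v // v ∉ T} => g v.1), sum_congr rfl (fun l _ => hgr l)]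
      simp
    have hlf : cls (fun v : {v // v ∉ T} => f v.1) l ≠ r := by
      have := cls_split T f l
      rw [hT2 f hf] at this
      omega
    have hle := card_compl_sub T
    obtain ⟨c, hc, hcc⟩ := ih r (by omega) {v // v ∉ T} (G.comap Subtype.val) hcard'
      (by omega) (deg_sub T hdeg) _ (pr_sub T hf) ⟨l, hlf⟩
    refine hNE (NE_shift (h := glue T c g) (m := 2) (pr_glue hc ?_ ?_) ?_ hcc)
    · intro a _ b _ hab; exact hg.1 a b hab
    · intro a ha b hb hab; exact absurd (hTcl a ha b hab) hb
    · intro l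
      rw [cls_glue, hT2 g hg.1]

end EqCol
namespace EqCol

open Finset

section conv

variable {V : Type} [Fintype V] {k : ℕ} {G : SimpleGraph V}

lemma chi_iff : G.chromaticNumber ≤ k ↔ ∃ f : V → Fin k, Pr G f := by
  rw [SimpleGraph.chromaticNumber_le_iff_colorable]
  constructor
  · rintro ⟨C⟩
    exact ⟨C, fun a b hab => C.valid hab⟩
  · rintro ⟨f, hf⟩
    exact ⟨SimpleGraph.Coloring.mk f (fun {a b} hab => hf a b hab)⟩

lemma nb_card [DecidableRel G.Adj] (v : V) : (nb G v).card = G.degree v := by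
  classical
  rw [← SimpleGraph.card_neighborFinset_eq_degree]
  congr 1
  ext w
  rw [mem_nb, SimpleGraph.mem_neighborFinset]

lemma deg_iff [DecidableRel G.Adj] : G.maxDegree ≤ k ↔ ∀ v, (nb G v).card ≤ k := by
  constructor
  · intro h v
    rw [nb_card]
    exact (G.degree_le_maxDegree v).trans h
  · intro h
    apply SimpleGraph.maxDegree_le_of_forall_degree_le
    intro v
    rw [← nb_card]
    exact h v

lemma eqc_iff : G.HasEquitableColoring k ↔ EqC G k := by
  constructor
  · rintro ⟨C, hC⟩
    exact ⟨C, fun a b hab => C.valid hab, hC⟩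
  · rintro ⟨f, hf, hb⟩
    exact ⟨SimpleGraph.Coloring.mk f (fun {a b} hab => hf a b hab), hb⟩

lemma cls_sum (g : V → Fin k) (c : Fin k) : cls g c = ∑ v, if g v = c then 1 else 0 := by
  unfold cls
  rw [card_filter]

lemma cls_equiv {W : Type} [Fintype W] (e : W ≃ V) (g : V → Fin k) (c : Fin k) :
    cls (fun w => g (e w)) c = cls g c := by
  rw [cls_sum, cls_sum]
  exact Equiv.sum_comp e (fun v => if g v = c then 1 else 0)

lemma cls_sum_type {A B : Type} [Fintype A] [Fintype B] (g : A ⊕ B → Fin k) (c : Fin k) :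
    cls g c = cls (fun a => g (Sum.inl a)) c + cls (fun b => g (Sum.inr b)) c := by
  rw [cls_sum, cls_sum, cls_sum, Fintype.sum_sum_type]

lemma parity {d : Fin k ⊕ Fin k → Fin k} (hd : ∀ p q, d (Sum.inl p) ≠ d (Sum.inr q))
    (h2 : ∀ l, cls d l = 2) : Even k := by
  have hsum := sum_cls (fun p => d (Sum.inl p))
  rw [Fintype.card_fin] at hsum
  rw [← hsum, even_iff_two_dvd]
  apply dvd_sum
  intro l _
  have h := h2 l
  rw [cls_sum_type] at h
  rcases Nat.eq_zero_or_pos (cls (fun p => d (Sum.inl p)) l) with h0 | h0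
  · rw [h0]; exact dvd_zero _
  rcases Nat.eq_zero_or_pos (cls (fun p => d (Sum.inr p)) l) with h1 | h1
  · rw [h1] at h; rw [show cls (fun p => d (Sum.inl p)) l = 2 by omega]
  · exfalso
    unfold cls at h0 h1
    obtain ⟨p, hp⟩ := card_pos.1 h0
    obtain ⟨q, hq⟩ := card_pos.1 h1
    rw [mem_filter] at hp hq
    exact hd p q (hp.2.trans hq.2.symm)

lemma back {m : ℕ} {H : SimpleGraph (Fin m)} (hH : H.IsKEquitable k)
    (φ : G ≃g SimpleGraph.disjUnion H (completeBipartiteGraph (Fin k) (Fin k)))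
    (hE : EqC G k) : Even k := by
  obtain ⟨s, hs, _, hall⟩ := hH
  obtain ⟨g, hg, hb⟩ := hE
  have hcard : Fintype.card V = k * (s + 2) := by
    rw [Fintype.card_congr φ.toEquiv, Fintype.card_sum, hs, Fintype.card_sum, Fintype.card_fin]
    ring
  have hcl : ∀ c, cls g c = s + 2 := by
    classical
    exact eq_of_balanced hcard hb
  have hpr : ∀ a b, (SimpleGraph.disjUnion H (completeBipartiteGraph (Fin k) (Fin k))).Adj a b →
      g (φ.symm a) ≠ g (φ.symm b) := fun a b hab => hg _ _ (φ.symm.map_rel_iff.2 hab)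
  have hcl2 : ∀ c, cls (fun p => g (φ.symm (Sum.inr p))) c = 2 := by
    intro c
    have h1 := cls_equiv φ.symm.toEquiv g c
    rw [cls_sum_type, hcl] at h1
    have h2 : cls (fun p => g (φ.symm (Sum.inl p))) c = s :=
      hall (SimpleGraph.Coloring.mk (fun p => g (φ.symm (Sum.inl p)))
        (fun {a b} hab => hpr (Sum.inl a) (Sum.inl b) hab)) c
    have h3 : cls (fun p => g (φ.symm (Sum.inl p))) c +
      cls (fun p => g (φ.symm (Sum.inr p))) c = s + 2 := h1
    omega
  refine parity (d := fun p => g (φ.symm (Sum.inr p))) ?_ hcl2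
  intro p q
  apply hpr
  show (completeBipartiteGraph (Fin k) (Fin k)).Adj (Sum.inl p) (Sum.inr q)
  simp

lemma forth {n : ℕ} (hA : HypA k n) (hk : 3 ≤ k) (hodd : Odd k) (hn : Fintype.card V ≤ n)
    (hcol : ∃ f : V → Fin k, Pr G f) (hdeg : ∀ v, (nb G v).card ≤ k) (hE : ¬ EqC G k) :
    ∃ (m : ℕ) (H : SimpleGraph (Fin m)), H.IsKEquitable k ∧
      Nonempty (G ≃g SimpleGraph.disjUnion H (completeBipartiteGraph (Fin k) (Fin k))) := by
  classical
  obtain ⟨f, hinj, hadj⟩ := hA V G hn hcol hdeg hE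
  have h : KK G f := ⟨hinj, hadj⟩
  have hdvd : k ∣ Fintype.card V := by
    by_contra hnd
    exact hE (thmZ2 hA hk hodd _ V G rfl hnd hn hcol hdeg)
  obtain ⟨s, hs⟩ := hdvd
  have hT := card_compl_sub (univ.image f)
  rw [h.card_T] at hT
  have hs2 : 2 ≤ s := by
    have : k * 2 ≤ k * s := by omega
    exact Nat.le_of_mul_le_mul_left this (by omega)
  obtain ⟨r, rfl⟩ : ∃ r, s = r + 2 := ⟨s - 2, by omega⟩
  have hcard' : Fintype.card {v // v ∉ univ.image f} = k * r := by
    rw [hs] at hT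
    have : k * (r + 2) = k * r + 2 * k := by ring
    omega
  obtain ⟨f0, hf0⟩ := hcol
  let e : Fin (Fintype.card {v // v ∉ univ.image f}) ≃ {v // v ∉ univ.image f} :=
    (Fintype.equivFin _).symm
  refine ⟨_, G.comap (fun x => (e x).1), ⟨r, ?_, ?_, ?_⟩, ?_⟩
  · rw [Fintype.card_fin]; exact hcard'
  · rw [chi_iff]
    exact ⟨fun x => f0 (e x).1, fun a b hab => hf0 _ _ hab⟩
  · intro C l
    by_contra hcon
    have hQ : NE (G.comap (Subtype.val : {v // v ∉ univ.image f} → V)) k r := by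
      refine thmQ hA hk hodd r _ _ hcard' (by omega) (deg_sub _ hdeg) (fun w => C (e.symm w)) ?_
        ⟨l, ?_⟩
      · intro a b hab
        apply C.valid
        show G.Adj (e (e.symm a)).1 (e (e.symm b)).1
        rw [Equiv.apply_symm_apply, Equiv.apply_symm_apply]
        exact hab
      · rw [cls_equiv e.symm (fun x => C x) l]
        exact hcon
    obtain ⟨c, hc, i, j, hij, hi, hj, hl⟩ := hQ
    obtain ⟨g, hg, g1, g2, g3⟩ := h.comb hdeg hk hodd hc hij
    apply hE
    have hcl : ∀ l, cls g l = r + 2 := by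
      intro l
      by_cases h1 : l = i
      · subst h1; omega
      by_cases h2 : l = j
      · subst h2; omega
      rw [g3 l h1 h2, hl l h1 h2]
    refine ⟨g, hg, ?_⟩
    intro a b
    rw [hcl, hcl]; omega
  · have hbij : Function.Bijective (Sum.elim (fun x => (e x).1) f) := by
      constructor
      · rintro (a | a) (b | b) hab
        · simp only [Sum.elim_inl] at hab
          rw [e.injective (Subtype.ext hab)]
        · simp only [Sum.elim_inl, Sum.elim_inr] at hab
          exact absurd (hab ▸ mem_image_of_mem f (mem_univ b)) (e a).2
        · simp only [Sum.elim_inl, Sum.elim_inr] at hab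
          exact absurd (hab ▸ mem_image_of_mem f (mem_univ a)) (e b).2
        · simp only [Sum.elim_inr] at hab
          rw [hinj hab]
      · intro v
        by_cases hv : v ∈ univ.image f
        · rw [mem_image] at hv
          obtain ⟨p, _, hp⟩ := hv
          exact ⟨Sum.inr p, hp⟩
        · refine ⟨Sum.inl (e.symm ⟨v, hv⟩), ?_⟩
          simp
    refine ⟨SimpleGraph.Iso.symm ⟨Equiv.ofBijective _ hbij, ?_⟩⟩
    rintro (a | a) (b | b)
    · exact Iff.rfl
    · constructor
      · intro hab
        exact absurd (G.adj_symm hab) (h.not_adj hdeg b (e a).2)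
      · intro hab; exact hab.elim
    · constructor
      · intro hab
        exact absurd hab (h.not_adj hdeg a (e b).2)
      · intro hab; exact hab.elim
    · show G.Adj (f a) (f b) ↔ (completeBipartiteGraph (Fin k) (Fin k)).Adj a b
      rcases a with a | a <;> rcases b with b | b
      · simp only [completeBipartiteGraph_adj, Sum.isLeft_inl, Sum.isRight_inl]
        constructor
        · intro hab
          obtain ⟨q, hq⟩ := h.nb_inl hdeg a hab
          exact absurd (hinj hq) (by simp)
        · simp
      · simp [hadj a b]
      · simp [(hadj b a).symm]
      · simp only [completeBipartiteGraph_adj, Sum.isLeft_inr, Sum.isRight_inr]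
        constructor
        · intro hab
          obtain ⟨q, hq⟩ := h.nb_inr hdeg a hab
          exact absurd (hinj hq) (by simp)
        · simp

end conv

end EqCol

open EqCol
theorem conjectures_equivalent (k₀ n₀ : ℕ) (hk₀ : 1 ≤ k₀) (hn₀ : 1 ≤ n₀) :
    (∀ (k : ℕ), 1 ≤ k → k ≤ k₀ →
      ∀ (V : Type) [Fintype V] (G : SimpleGraph V) [DecidableRel G.Adj],
        Fintype.card V ≤ n₀ → G.chromaticNumber ≤ k → G.maxDegree ≤ k →
        ¬ G.HasEquitableColoring k →
        (Odd k ∧ ∃ f : completeBipartiteGraph (Fin k) (Fin k) →g G, Function.Injective f)) ↔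
    (∀ (k : ℕ), 1 ≤ k → k ≤ k₀ →
      ∀ (V : Type) [Fintype V] (G : SimpleGraph V) [DecidableRel G.Adj],
        Fintype.card V ≤ n₀ → G.chromaticNumber ≤ k → G.maxDegree ≤ k →
        (¬ G.HasEquitableColoring k ↔
          (Odd k ∧ ∃ (m : ℕ) (H : SimpleGraph (Fin m)), H.IsKEquitable k ∧
            Nonempty (G ≃g SimpleGraph.disjUnion H
              (completeBipartiteGraph (Fin k) (Fin k)))))) := by
  constructor
  · intro A k hk1 hkk V _ G _ hn hchi hD
    have hcol := chi_iff.1 hchi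
    have hdeg := deg_iff.1 hD
    constructor
    · intro hE
      obtain ⟨hodd, f, hf⟩ := A k hk1 hkk V G hn hchi hD hE
      refine ⟨hodd, ?_⟩
      have hk3 : 3 ≤ k := by
        by_contra hlt
        obtain ⟨t, ht⟩ := hodd
        have hk : k = 1 := by omega
        subst hk
        obtain ⟨c, hc⟩ := hcol
        have hadj : G.Adj (f (Sum.inl 0)) (f (Sum.inr 0)) := f.map_rel (by simp)
        exact hc _ _ hadj (Subsingleton.elim _ _)
      have hA : HypA k n₀ := by
        intro W _ G' hn' hcol' hdeg' hE'
        classical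
        obtain ⟨_, f', hf'⟩ := A k hk1 hkk W G' hn' (chi_iff.2 hcol') (deg_iff.2 hdeg')
          (fun h => hE' (eqc_iff.1 h))
        exact ⟨f', hf', fun i j => f'.map_rel (by simp)⟩
      exact forth hA hk3 hodd hn hcol hdeg (fun h => hE (eqc_iff.2 h))
    · rintro ⟨hodd, m, H, hH, ⟨φ⟩⟩ hE
      have := back hH φ (eqc_iff.1 hE)
      exact (Nat.not_even_iff_odd.2 hodd) this
  · intro B k hk1 hkk V _ G _ hn hchi hD hE
    obtain ⟨hodd, m, H, hH, ⟨φ⟩⟩ := (B k hk1 hkk V G hn hchi hD).1 hE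
    refine ⟨hodd, ⟨fun p => φ.symm (Sum.inr p), ?_⟩, ?_⟩
    · intro a b hab
      exact φ.symm.map_rel_iff.2 hab
    · intro a b hab
      exact Sum.inr_injective (φ.symm.injective hab)
end
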